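/- arXiv:2503.04124 — 4 statements merged into one kernel-verified Lean document; each statement's English description precedes it below -/
import Mathlib

section
/- Let G be a connected triangle-free simple graph on n vertices with n ≥ 15 and minimum degree δ(G) ≥ 2. Then the hop domination number of G satisfies γ_h(G) ≤ 2n/5 (equivalently, 5·γ_h(G) ≤ 2n). -/
/-- A set `S` of vertices is a hop dominating set of `G` if every vertex not in `S`
is at distance exactly 2 from some vertex of `S`. -/
def SimpleGraph.IsHopDominatingSet {V : Type*} (G : SimpleGraph V) (S : Finset V) : Prop :=
  ∀ v : V, v ∉ S → ∃ u ∈ S, G.dist u v = 2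

/-- The hop domination number of `G`: the minimum cardinality of a hop dominating set. -/
noncomputable def SimpleGraph.hopDominationNumber {V : Type*} [Fintype V]
    (G : SimpleGraph V) : ℕ :=
  sInf {k : ℕ | ∃ S : Finset V, G.IsHopDominatingSet S ∧ S.card = k}

namespace SimpleGraph

universe u

variable {V : Type u} {G : SimpleGraph V}

/-- `v` is equal to `s` or joined to `s` by a walk of length two. -/
def Near (G : SimpleGraph V) (s v : V) : Prop :=
  s = v ∨ ∃ w, G.Adj s w ∧ G.Adj w v

/-- Some vertex of `S` is equal to `v` or joined to `v` by a walk of length two. -/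
def Covers (G : SimpleGraph V) (S : Finset V) (v : V) : Prop :=
  ∃ s ∈ S, G.Near s v

lemma Covers.mono {S T : Finset V} {v : V} (h : G.Covers S v) (hST : S ⊆ T) : G.Covers T v := by
  obtain ⟨s, hs, h⟩ := h
  exact ⟨s, hST hs, h⟩

lemma covers_of_mem {S : Finset V} {v : V} (h : v ∈ S) : G.Covers S v :=
  ⟨v, h, Or.inl rfl⟩

lemma covers_of_adj {S : Finset V} {s w v : V} (h : s ∈ S) (h1 : G.Adj s w) (h2 : G.Adj w v) :
    G.Covers S v :=
  ⟨s, h, Or.inr ⟨w, h1, h2⟩⟩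

/-- Every vertex outside `D` has two distinct neighbours. -/
def TwoNbrs (G : SimpleGraph V) (D : Set V) : Prop :=
  ∀ v, v ∉ D → ∃ a b, a ≠ b ∧ G.Adj v a ∧ G.Adj v b

lemma TwoNbrs.exists_ne {D : Set V} (hD : G.TwoNbrs D) {v : V} (hv : v ∉ D) (a : V) :
    ∃ b, b ≠ a ∧ G.Adj v b := by
  obtain ⟨b, c, hbc, hb, hc⟩ := hD v hv
  by_cases h : b = a
  · exact ⟨c, fun h' => hbc (h.trans h'.symm), hc⟩
  · exact ⟨b, h, hb⟩

/-- A list of vertices forming a path. -/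
def IsPathList (G : SimpleGraph V) (l : List V) : Prop :=
  l.IsChain G.Adj ∧ l.Nodup

/-- A list of vertices forming a path of maximum length. -/
def IsLongest (G : SimpleGraph V) (l : List V) : Prop :=
  G.IsPathList l ∧ ∀ l', G.IsPathList l' → l'.length ≤ l.length

lemma isPathList_cons_cons {a b : V} {l : List V} :
    G.IsPathList (a :: b :: l) ↔ G.Adj a b ∧ a ∉ b :: l ∧ G.IsPathList (b :: l) := by
  simp only [IsPathList, List.isChain_cons_cons, List.nodup_cons (a := a)]
  tauto

lemma isPathList_singleton (a : V) : G.IsPathList [a] := by simp [IsPathList]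

lemma exists_isLongest [Fintype V] : ∃ l, G.IsLongest l := by
  have hb : BddAbove {k | ∃ l, G.IsPathList l ∧ l.length = k} :=
    ⟨Fintype.card V, by rintro k ⟨l, hl, rfl⟩; exact hl.2.length_le_card⟩
  have hne : {k | ∃ l, G.IsPathList l ∧ l.length = k}.Nonempty := ⟨0, [], by simp [IsPathList]⟩
  obtain ⟨l, hl, h⟩ := Nat.sSup_mem hne hb
  exact ⟨l, hl, fun l' hl' => h ▸ le_csSup hb ⟨l', hl', rfl⟩⟩

lemma IsLongest.mem_of_adj {x w : V} {t : List V} (h : G.IsLongest (x :: t)) (hw : G.Adj x w) :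
    w ∈ x :: t := by
  by_contra hmem
  have := h.2 (w :: x :: t) (isPathList_cons_cons.2 ⟨hw.symm, hmem, h.1⟩)
  simp at this

lemma reach_cases {H : SimpleGraph V} {y z : V} (h : H.Reachable y z) :
    z = y ∨ H.Adj y z ∨ (∃ a, H.Adj y a ∧ H.Adj a z) ∨
      (∃ a b, H.IsPathList [y, a, b, z]) ∨ ∃ a b c d, H.IsPathList [y, a, b, c, d] := by
  obtain ⟨w⟩ := h.symm
  clear h
  induction w with
  | nil => exact Or.inl rfl
  | @cons z z' y hz w ih =>
    have hz := hz.symm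
    simp only [isPathList_cons_cons, List.mem_cons, isPathList_singleton, List.not_mem_nil,
      or_false, and_true, not_or] at ih ⊢
    by_cases h1 : z = y
    · exact Or.inl h1
    by_cases h2 : H.Adj y z
    · exact Or.inr (Or.inl h2)
    by_cases h3 : ∃ a, H.Adj y a ∧ H.Adj a z
    · exact Or.inr (Or.inr (Or.inl h3))
    push Not at h3
    rcases ih with rfl | h | ⟨a, ha, haz⟩ | ⟨a, b, hya, ⟨n1, n2, n3⟩, hab, ⟨n4, n5⟩, hbz, n6⟩ | h
    · exact absurd hz h2
    · exact absurd hz (h3 _ h)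
    · refine Or.inr (Or.inr (Or.inr (Or.inl ⟨a, z', ha, ⟨ha.ne, ?_, Ne.symm h1⟩, haz,
        ⟨haz.ne, ?_⟩, hz, hz.ne⟩)))
      · rintro rfl; exact h2 hz
      · rintro rfl; exact h2 ha
    · refine Or.inr (Or.inr (Or.inr (Or.inr ⟨a, b, z', z, hya, ⟨n1, n2, n3, Ne.symm h1⟩, hab,
        ⟨n4, n5, ?_⟩, hbz, ⟨n6, ?_⟩, hz, hz.ne⟩)))
      · rintro rfl; exact h2 hya
      · rintro rfl; exact h3 _ hya hab
    · exact Or.inr (Or.inr (Or.inr (Or.inr h)))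

/-- The graph obtained from `G` by deleting all edges meeting `B`. -/
def avoid (G : SimpleGraph V) (B : Set V) : SimpleGraph V where
  Adj a b := G.Adj a b ∧ a ∉ B ∧ b ∉ B
  symm := ⟨fun _ _ h => ⟨h.1.symm, h.2.2, h.2.1⟩⟩
  loopless := ⟨fun _ h => h.1.ne rfl⟩

lemma avoid_le (B : Set V) : G.avoid B ≤ G := fun _ _ h => h.1

lemma IsPathList.mono {H : SimpleGraph V} (h : H ≤ G) {l : List V} (hl : H.IsPathList l) :
    G.IsPathList l :=
  ⟨hl.1.imp fun _ _ h' => h h', hl.2⟩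

lemma reachable_avoid_notMem {B : Set V} {q v : V} (hq : q ∉ B) (h : (G.avoid B).Reachable q v) :
    v ∉ B := by
  obtain ⟨w⟩ := h.symm
  cases w with
  | nil => exact hq
  | cons h _ => exact h.2.1

lemma reachable_avoid_step {B : Set V} {q v w : V} (hq : q ∉ B)
    (h : (G.avoid B).Reachable q v) (hvw : G.Adj v w) (hw : w ∉ B) :
    (G.avoid B).Reachable q w :=
  h.trans (Adj.reachable (G := G.avoid B) ⟨hvw, reachable_avoid_notMem hq h, hw⟩)

/-- A set closed under adjacency from `q` contains everything reachable. -/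
lemma Reachable.mem_of_closed {H : SimpleGraph V} {q v : V} (h : H.Reachable q v) {Y : Set V}
    (hq : q ∈ Y) (hY : ∀ a ∈ Y, ∀ b, H.Adj a b → b ∈ Y) : v ∈ Y := by
  obtain ⟨w⟩ := h
  induction w with
  | nil => exact hq
  | cons h _ ih => exact ih (hY _ hq _ h)

lemma exists_adj_of_avoid (hG : G.Connected) {B : Set V} {z b : V} (hb : b ∈ B) (hz : z ∉ B) :
    ∃ y, (G.avoid B).Reachable z y ∧ ∃ x ∈ B, G.Adj y x := by
  by_contra! hcon
  refine reachable_avoid_notMem (G := G) hz ?_ hb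
  exact (hG.preconnected z b).mem_of_closed (Y := {v | (G.avoid B).Reachable z v})
    (Reachable.refl _) fun a ha c hac => reachable_avoid_step hz ha hac fun hc => hcon a ha c hc hac

lemma reachable_of_isPathList {H : SimpleGraph V} {a : V} {l : List V}
    (h : H.IsPathList (a :: l)) {v : V} (hv : v ∈ a :: l) : H.Reachable a v := by
  induction l generalizing a with
  | nil => simp at hv; rw [hv]
  | cons b l ih =>
    rw [isPathList_cons_cons] at h
    rcases List.mem_cons.1 hv with rfl | hv
    · rfl
    · exact h.1.reachable.trans (ih h.2.2 hv)

lemma avoid_isPathList {B : Set V} {l : List V} (h : G.IsPathList l) (hl : ∀ v ∈ l, v ∉ B) :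
    (G.avoid B).IsPathList l := by
  refine ⟨?_, h.2⟩
  have h1 := h.1
  clear h
  induction l with
  | nil => simp
  | cons a l ih =>
    cases l with
    | nil => simp
    | cons b l =>
      rw [List.isChain_cons_cons] at h1 ⊢
      exact ⟨⟨h1.1, hl _ (by simp), hl _ (by simp)⟩, ih (fun v hv => hl v (by simp [hv])) h1.2⟩

lemma connected_induce_avoid {B : Set V} {q : V} (hq : q ∉ B) {M : Set V}
    (hM : ∀ v, v ∈ M ↔ (G.avoid B).Reachable q v) : (G.induce M).Connected := by
  have hqM : q ∈ M := (hM q).2 (Reachable.refl _)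
  have key : ∀ v (hv : v ∈ M), (G.induce M).Reachable ⟨v, hv⟩ ⟨q, hqM⟩ := by
    intro v hv
    obtain ⟨w⟩ := ((hM v).1 hv).symm
    induction w with
    | nil => rfl
    | @cons a b _ h w ih =>
      have hb : b ∈ M := (hM b).2 ⟨w.reverse⟩
      exact (Adj.reachable (G := G.induce M) (u := ⟨a, hv⟩) (v := ⟨b, hb⟩) h.1).trans (ih hq hM hqM hb)
  have : Nonempty M := ⟨⟨q, hqM⟩⟩
  exact ⟨fun a b => (key a a.2).trans (key b b.2).symm⟩

lemma isPathList_cons_avoid {B : Set V} {c y : V} (hc : c ∈ B) (hy : y ∉ B) {l : List V}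
    (h : (G.avoid B).IsPathList (y :: l)) (hcy : G.Adj c y) : G.IsPathList (c :: y :: l) :=
  isPathList_cons_cons.2 ⟨hcy,
    fun hmem => reachable_avoid_notMem hy (reachable_of_isPathList h hmem) hc,
    h.mono (avoid_le B)⟩

open scoped Classical in
/-- If `U` is a union of components of `G - c` with no long path starting at `c`, then few
neighbours of `c` together with `c` cover all of `U` but some neighbours of `c`. -/
lemma exists_centers (hG : G.Connected) {D : Set V} (hD : G.TwoNbrs D) (c : V) (U : Finset V)
    (hcU : c ∉ U) (hU : ∀ u ∈ U, ∀ w, G.Adj u w → w ∈ U ∨ w = c)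
    (h5 : ∀ l, G.IsPathList (c :: l) → (∀ v ∈ l, v ∈ U) → l.length ≤ 4) :
    ∃ A : Finset V, 4 * A.card ≤ U.card ∧ (∀ a ∈ A, G.Adj c a) ∧
      ((∃ l, G.IsPathList (c :: l) ∧ (∀ v ∈ l, v ∈ U) ∧ l.length = 4) → A.Nonempty) ∧
      ∀ v ∈ U, v ∈ D ∨ G.Adj c v ∨ G.Covers (insert c A) v := by
  induction U using Finset.strongInduction with
  | H U ih =>
    have hmemU : ∀ {y v}, y ∈ U → (G.avoid {c}).Reachable y v → v ∈ U := fun hy h =>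
      h.mem_of_closed (Y := {v | v ∈ U}) hy fun a ha b hab =>
        (hU a ha b hab.1).resolve_right hab.2.2
    have hne : ∀ {y}, y ∈ U → y ∉ ({c} : Set V) := fun hy h => hcU (h ▸ hy)
    have hpath : ∀ {y l}, y ∈ U → G.Adj c y → (G.avoid {c}).IsPathList (y :: l) →
        G.IsPathList (c :: y :: l) ∧ ∀ v ∈ y :: l, v ∈ U := fun hy hcy hl =>
      ⟨isPathList_cons_avoid (Set.mem_singleton c) (hne hy) hl hcy,
        fun v hv => hmemU hy (reachable_of_isPathList hl hv)⟩
    by_cases h4 : ∃ l, G.IsPathList (c :: l) ∧ (∀ v ∈ l, v ∈ U) ∧ l.length = 4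
    · obtain ⟨l, hl, hlU, hlen⟩ := h4
      obtain ⟨a, l, rfl⟩ : ∃ a l', l = a :: l' := by
        cases l with
        | nil => simp at hlen
        | cons a l => exact ⟨a, l, rfl⟩
      have haU : a ∈ U := hlU a (by simp)
      have hca : G.Adj c a := (isPathList_cons_cons.1 hl).1
      set K := U.filter fun v => (G.avoid {c}).Reachable a v with hK
      set U' := U.filter fun v => ¬ (G.avoid {c}).Reachable a v with hU'
      have hKcard : 4 ≤ K.card := by
        have hsub : (a :: l).toFinset ⊆ K := by
          intro v hv
          rw [List.mem_toFinset] at hv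
          have hal := (isPathList_cons_cons.1 hl).2.2
          refine Finset.mem_filter.2 ⟨hlU v hv, reachable_of_isPathList
            (avoid_isPathList hal fun v hv => hne (hlU v hv)) hv⟩
        have := Finset.card_le_card hsub
        rwa [List.toFinset_card_of_nodup (isPathList_cons_cons.1 hl).2.2.2, hlen] at this
      have hsum : K.card + U'.card = U.card := Finset.card_filter_add_card_filter_not _
      have hss : U' ⊂ U := Finset.filter_ssubset.2 ⟨a, haU, not_not.2 (Reachable.refl _)⟩
      obtain ⟨A, hA1, hA2, -, hA4⟩ := ih U' hss (fun h => hcU (hss.1 h))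
        (by
          intro u hu w huw
          obtain ⟨hu1, hu2⟩ := Finset.mem_filter.1 hu
          rcases hU u hu1 w huw with hw | hw
          · refine Or.inl (Finset.mem_filter.2 ⟨hw, fun h => hu2 ?_⟩)
            exact reachable_avoid_step (hne haU) h huw.symm (hne hu1)
          · exact Or.inr hw)
        (fun l hl hlU' => h5 l hl fun v hv => hss.1 (hlU' v hv))
      refine ⟨insert a A, ?_, ?_, fun _ => ⟨a, by simp⟩, ?_⟩
      · have := Finset.card_insert_le a A
        omega
      · intro b hb
        rcases Finset.mem_insert.1 hb with rfl | hb
        · exact hca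
        · exact hA2 b hb
      · intro v hv
        by_cases hr : (G.avoid {c}).Reachable a v
        · rcases reach_cases hr with rfl | h | ⟨x, hx, hxv⟩ | ⟨x, y, hp⟩ | ⟨x, y, z, t, hp⟩
          · exact Or.inr (Or.inl hca)
          · exact Or.inr (Or.inr (covers_of_adj (s := c) (by simp) hca h.1))
          · exact Or.inr (Or.inr (covers_of_adj (s := a) (by simp) hx.1 hxv.1))
          · by_cases hvD : v ∈ D
            · exact Or.inl hvD
            obtain ⟨w, hwy, hvw⟩ := hD.exists_ne hvD y
            by_cases hwc : w = c
            · exact Or.inr (Or.inl (hwc ▸ hvw.symm))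
            by_cases hwa : w = a
            · exact Or.inr (Or.inr (covers_of_adj (s := c) (by simp) hca (hwa ▸ hvw.symm)))
            have hp' := hp
            simp only [isPathList_cons_cons, List.mem_cons, isPathList_singleton, List.not_mem_nil,
              or_false, and_true, not_or] at hp'
            by_cases hwx : w = x
            · exact Or.inr (Or.inr (covers_of_adj (s := a) (by simp) hp'.1.1 (hwx ▸ hvw.symm)))
            have hp5 : (G.avoid {c}).IsPathList [a, x, y, v, w] := by
              simp only [isPathList_cons_cons, List.mem_cons, isPathList_singleton,
                List.not_mem_nil, or_false, and_true, not_or]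
              have hvw' : (G.avoid {c}).Adj v w := ⟨hvw, hne hv, hwc⟩
              have := hvw.ne
              have := Ne.symm hwy
              have := Ne.symm hwa
              have := Ne.symm hwx
              tauto
            have := h5 _ (hpath haU hca hp5).1 (hpath haU hca hp5).2
            simp at this
          · have := h5 _ (hpath haU hca hp).1 (hpath haU hca hp).2
            simp at this
        · rcases hA4 v (Finset.mem_filter.2 ⟨hv, hr⟩) with h | h | h
          · exact Or.inl h
          · exact Or.inr (Or.inl h)
          · exact Or.inr (Or.inr (h.mono (Finset.insert_subset_insert _ (Finset.subset_insert _ _))))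
    · refine ⟨∅, by simp, by simp, fun h => absurd h h4, fun v hv => ?_⟩
      have key : ∀ {y a b z}, y ∈ U → G.Adj c y → ¬ (G.avoid {c}).IsPathList [y, a, b, z] :=
        fun hy hcy hl => h4 ⟨_, (hpath hy hcy hl).1, (hpath hy hcy hl).2, rfl⟩
      obtain ⟨y, hvy, x, rfl, hyx⟩ := exists_adj_of_avoid hG (Set.mem_singleton c) (hne hv)
      have hyU := hmemU hv hvy
      have hcy := hyx.symm
      rcases reach_cases hvy.symm with rfl | h | ⟨a, ha, hav⟩ | ⟨a, b, hp⟩ | ⟨a, b, z, t, hp⟩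
      · exact Or.inr (Or.inl hcy)
      · exact Or.inr (Or.inr (covers_of_adj (s := x) (by simp) hcy h.1))
      · by_cases hvD : v ∈ D
        · exact Or.inl hvD
        obtain ⟨w, hwa, hvw⟩ := hD.exists_ne hvD a
        by_cases hwc : w = x
        · exact Or.inr (Or.inl (hwc ▸ hvw.symm))
        by_cases hwy : w = y
        · exact Or.inr (Or.inr (covers_of_adj (s := x) (by simp) hcy (hwy ▸ hvw.symm)))
        by_cases hvy' : v = y
        · exact Or.inr (Or.inl (hvy' ▸ hcy))
        refine absurd ?_ (key (a := a) (b := v) (z := w) hyU hcy)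
        simp only [isPathList_cons_cons, List.mem_cons, isPathList_singleton,
          List.not_mem_nil, or_false, and_true, not_or]
        have hvw' : (G.avoid {x}).Adj v w := ⟨hvw, hne hv, hwc⟩
        have := hvw.ne
        have := ha.ne
        have := hav.ne
        have := Ne.symm hwy
        have := Ne.symm hwa
        have := Ne.symm hvy'
        tauto
      · exact absurd hp (key hyU hcy)
      · have := h5 _ (hpath hyU hcy hp).1 (hpath hyU hcy hp).2
        simp at this

/-- At most two fifths of the vertices suffice to cover all vertices outside `D`. -/
def Good [Fintype V] (G : SimpleGraph V) (D : Set V) : Prop :=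
  ∃ S : Finset V, 5 * S.card ≤ 2 * Fintype.card V ∧ ∀ v, v ∈ D ∨ G.Covers S v

/-- No two neighbours of a vertex are adjacent. -/
def TriFree (G : SimpleGraph V) : Prop :=
  ∀ a b c, G.Adj a b → G.Adj b c → ¬ G.Adj a c

open scoped Classical in
lemma good_of_length_le_four [Fintype V] (hG : G.Connected) (hT : G.TriFree) {D : Set V}
    (hD : G.TwoNbrs D) {l : List V} (hl : G.IsLongest l) (h4 : l.length ≤ 4) :
    G.Good D ∨ Fintype.card V = 4 := by
  have hcard : l.length ≤ Fintype.card V := hl.1.2.length_le_card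
  obtain ⟨hp, hmax⟩ := hl
  match l with
  | [] =>
    have := hG.nonempty
    have := hmax [Classical.arbitrary V] (isPathList_singleton _)
    simp at this
  | [_] | [_, _] =>
    refine Or.inl ⟨∅, by simp, fun v => Or.inl ?_⟩
    by_contra hv
    obtain ⟨a, b, hab, ha, hb⟩ := hD v hv
    have := hmax [a, v, b] (by
      simp [isPathList_cons_cons, isPathList_singleton, ha.symm, hb, hab, ha.ne', hb.ne])
    simp at this
  | [x0, x1, x2] =>
    left
    simp only [List.length_cons, List.length_nil] at hcard
    simp only [isPathList_cons_cons, List.mem_cons, isPathList_singleton, List.not_mem_nil,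
      or_false, and_true, not_or] at hp
    refine ⟨{x1}, by simp; omega, fun v => ?_⟩
    rcases reach_cases (hG.preconnected x1 v) with rfl | h | ⟨a, ha, hav⟩ | ⟨a, b, h⟩ | ⟨a, b, c, d, h⟩
    · exact Or.inr (covers_of_mem (by simp))
    · by_cases hv : v ∈ D
      · exact Or.inl hv
      exfalso
      obtain ⟨w, hw1, hw⟩ := hD.exists_ne hv x1
      have hwx : ∀ x, G.Adj x x1 → w ≠ x := fun x hx e => hT x1 v w h hw (e ▸ hx.symm)
      have hgo : ∀ x, G.Adj x x1 → x ≠ v → False := fun x hx hxv => by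
        have := hmax [x, x1, v, w] (by
          simp [isPathList_cons_cons, isPathList_singleton, h, hx, hw, hx.ne, hxv,
            (hwx x hx).symm, h.ne, hw1.symm, hw.ne])
        simp at this
      by_cases e : x0 = v
      · exact hgo x2 hp.2.2.1.symm fun e' => hp.2.1.2 (e.trans e'.symm)
      · exact hgo x0 hp.1 e
    · exact Or.inr (covers_of_adj (by simp) ha hav)
    · have := hmax _ h
      simp at this
    · have := hmax _ h
      simp at this
  | [x0, x1, x2, x3] =>
    simp only [List.length_cons, List.length_nil] at hcard
    by_cases hc4 : Fintype.card V = 4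
    · exact Or.inr hc4
    left
    simp only [isPathList_cons_cons, List.mem_cons, isPathList_singleton, List.not_mem_nil,
      or_false, and_true, not_or] at hp
    have h12 := hp.2.2.1
    refine ⟨{x1, x2}, ?_, fun v => Or.inr ?_⟩
    · have := Finset.card_le_two (a := x1) (b := x2)
      omega
    rcases reach_cases (hG.preconnected x1 v) with rfl | h | ⟨a, ha, hav⟩ | ⟨a, b, h⟩ | ⟨a, b, c, d, h⟩
    · exact covers_of_mem (by simp)
    · exact covers_of_adj (s := x2) (by simp) h12.symm h
    · exact covers_of_adj (s := x1) (by simp) ha hav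
    · have h' := h
      simp only [isPathList_cons_cons, List.mem_cons, isPathList_singleton, List.not_mem_nil,
        or_false, and_true, not_or] at h'
      obtain ⟨h1a, -, hab, -, hbv, -⟩ := h'
      by_cases ea : x2 = a
      · exact covers_of_adj (s := x2) (by simp) (ea ▸ hab) hbv
      by_cases eb : x2 = b
      · exact covers_of_adj (s := x1) (by simp) h12 (eb ▸ hbv)
      by_cases ev : x2 = v
      · exact covers_of_mem (by simp [ev])
      have := hmax [x2, x1, a, b, v] (isPathList_cons_cons.2
        ⟨h12.symm, by simp [ea, eb, ev, h12.ne'], h⟩)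
      simp at this
    · have := hmax _ h
      simp at this
  | _ :: _ :: _ :: _ :: _ :: _ => simp at h4; omega

/-- A list of vertices each adjacent to the next one cyclically. -/
def IsCyclicList (G : SimpleGraph V) (l : List V) : Prop :=
  (l ++ l).IsChain G.Adj

lemma IsCyclicList.rotate {s t : List V} (h : G.IsCyclicList (s ++ t)) :
    G.IsCyclicList (t ++ s) := by
  unfold IsCyclicList at *
  rcases List.eq_nil_or_concat s with rfl | ⟨s, a, rfl⟩
  · simpa using h
  rcases List.eq_nil_or_concat t with rfl | ⟨t, b, rfl⟩
  · simpa using h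
  simp only [List.isChain_append, List.isChain_append] at h ⊢
  simp at h ⊢
  grind

lemma IsCyclicList.isChain {l : List V} (h : G.IsCyclicList l) : l.IsChain G.Adj :=
  (List.isChain_append.1 h).1

lemma isCyclicList_cons {x y : V} {l : List V} (h : (x :: l).IsChain G.Adj)
    (hy : (x :: l).getLast? = some y) (hxy : G.Adj y x) : G.IsCyclicList (x :: l) :=
  List.isChain_append.2 ⟨h, h, by simp [hy, hxy]⟩

lemma IsCyclicList.mem_of_isLongest (hG : G.Connected) {l : List V} (hc : G.IsCyclicList l)
    (hl : G.IsLongest l) (hne : l ≠ []) (v : V) : v ∈ l := by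
  obtain ⟨x, hx⟩ := List.exists_mem_of_ne_nil l hne
  refine (hG.preconnected x v).mem_of_closed (Y := {v | v ∈ l}) hx fun a ha b hab => ?_
  by_contra hb
  obtain ⟨s, t, rfl⟩ := List.append_of_mem (show a ∈ l from ha)
  have hc' := hc.rotate.isChain
  have hperm : (s ++ a :: t).Perm (a :: t ++ s) := List.perm_append_comm
  have := hl.2 (b :: (a :: t ++ s)) (isPathList_cons_cons.2 ⟨hab.symm,
    fun h => hb (hperm.mem_iff.2 h), hc', hperm.nodup_iff.1 hl.1.2⟩)
  rw [List.length_cons, ← hperm.length_eq] at this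
  omega

open scoped Classical in
lemma exists_cover_isChain (l : List V) (h : l.IsChain G.Adj) :
    ∃ S : Finset V, S.card ≤ 2 * (l.length / 6) + min (l.length % 6) 2 ∧
      ∀ v ∈ l, G.Covers S v := by
  match l with
  | [] => exact ⟨∅, by simp, by simp⟩
  | [a] => exact ⟨{a}, by simp, by simp [covers_of_mem]⟩
  | [a, b] =>
    exact ⟨{a, b}, Finset.card_le_two.trans (by simp), fun v hv => covers_of_mem (by simpa using hv)⟩
  | [a, b, c] =>
    simp only [List.isChain_cons_cons] at h
    refine ⟨{a, b}, Finset.card_le_two.trans (by simp), ?_⟩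
    simp only [List.mem_cons, List.not_mem_nil, or_false, forall_eq_or_imp, forall_eq]
    exact ⟨covers_of_mem (by simp), covers_of_mem (by simp),
      covers_of_adj (s := a) (by simp) h.1 h.2.1⟩
  | [a, b, c, d] =>
    simp only [List.isChain_cons_cons] at h
    refine ⟨{b, c}, Finset.card_le_two.trans (by simp), ?_⟩
    simp only [List.mem_cons, List.not_mem_nil, or_false, forall_eq_or_imp, forall_eq]
    exact ⟨covers_of_adj (s := c) (by simp) h.2.1.symm h.1.symm, covers_of_mem (by simp),
      covers_of_mem (by simp), covers_of_adj (s := b) (by simp) h.2.1 h.2.2.1⟩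
  | [a, b, c, d, e] =>
    simp only [List.isChain_cons_cons] at h
    refine ⟨{b, c}, Finset.card_le_two.trans (by simp), ?_⟩
    simp only [List.mem_cons, List.not_mem_nil, or_false, forall_eq_or_imp, forall_eq]
    exact ⟨covers_of_adj (s := c) (by simp) h.2.1.symm h.1.symm, covers_of_mem (by simp),
      covers_of_mem (by simp), covers_of_adj (s := b) (by simp) h.2.1 h.2.2.1,
      covers_of_adj (s := c) (by simp) h.2.2.1 h.2.2.2.1⟩
  | a :: b :: c :: d :: e :: f :: l =>
    have hl : l.IsChain G.Adj := by
      have := h.tail.tail.tail.tail.tail.tail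
      simpa using this
    simp only [List.isChain_cons_cons] at h
    have h5 : G.Adj e f := h.2.2.2.2.1
    obtain ⟨S, hS, hcov⟩ := exists_cover_isChain l hl
    refine ⟨{c, d} ∪ S, ?_, ?_⟩
    · have := Finset.card_union_le {c, d} S
      have := Finset.card_le_two (a := c) (b := d)
      simp only [List.length_cons]
      omega
    · simp only [List.mem_cons, forall_eq_or_imp]
      exact ⟨covers_of_adj (s := c) (by simp) h.2.1.symm h.1.symm,
        covers_of_adj (s := d) (by simp) h.2.2.1.symm h.2.1.symm, covers_of_mem (by simp),
        covers_of_mem (by simp), covers_of_adj (s := c) (by simp) h.2.2.1 h.2.2.2.1,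
        covers_of_adj (s := d) (by simp) h.2.2.2.1 h5,
        fun v hv => (hcov v hv).mono Finset.subset_union_right⟩

lemma good_of_isCyclicList [Fintype V] {D : Set V} {l : List V} (hc : G.IsCyclicList l)
    (hnd : l.Nodup) (hall : ∀ v, v ∈ l) (h5 : 5 ≤ Fintype.card V) :
    G.Good D ∨ D = ∅ ∧ (Fintype.card V = 7 ∨ Fintype.card V = 8 ∨ Fintype.card V = 14) := by
  classical
  have hlen : l.length = Fintype.card V := by
    rw [← List.toFinset_card_of_nodup hnd, ← Finset.card_univ]
    congr 1
    ext v
    simp [hall v]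
  by_cases h9 : Fintype.card V = 9
  · left
    rw [h9] at hlen
    match l, hlen with
    | [a, b, c, d, e, f, g, h, i], _ =>
      refine ⟨{c, f, i}, ?_, fun v => Or.inr ?_⟩
      · have := Finset.card_le_three (a := c) (b := f) (c := i)
        omega
      · have hv := hall v
        simp only [IsCyclicList, List.cons_append, List.nil_append, List.isChain_cons_cons] at hc
        simp only [List.mem_cons, List.not_mem_nil, or_false] at hv
        obtain ⟨h1, h2, h3, h4, h5, h6, h7, h8, h9, -⟩ := hc
        rcases hv with rfl | rfl | rfl | rfl | rfl | rfl | rfl | rfl | rfl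
        · exact covers_of_adj (s := c) (by simp) h2.symm h1.symm
        · exact covers_of_adj (s := i) (by simp) h9 h1
        · exact covers_of_mem (by simp)
        · exact covers_of_adj (s := f) (by simp) h5.symm h4.symm
        · exact covers_of_adj (s := c) (by simp) h3 h4
        · exact covers_of_mem (by simp)
        · exact covers_of_adj (s := i) (by simp) h8.symm h7.symm
        · exact covers_of_adj (s := f) (by simp) h6 h7
        · exact covers_of_mem (by simp)
  by_cases h7 : Fintype.card V = 7 ∨ Fintype.card V = 8 ∨ Fintype.card V = 14
  · rcases D.eq_empty_or_nonempty with rfl | ⟨d, hd⟩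
    · exact Or.inr ⟨rfl, h7⟩
    left
    obtain ⟨s, t, rfl⟩ := List.append_of_mem (hall d)
    have hch : (t ++ s).IsChain G.Adj := by
      have := hc.rotate.isChain
      rw [List.cons_append] at this
      exact this.tail
    obtain ⟨S, hS, hcov⟩ := exists_cover_isChain _ hch
    simp only [List.length_append, List.length_cons] at hlen hS
    refine ⟨S, ?_, fun v => ?_⟩
    · omega
    · have := hall v
      by_cases hv : v = d
      · exact Or.inl (hv ▸ hd)
      · refine Or.inr (hcov v ?_)
        simp only [List.mem_append, List.mem_cons] at this ⊢
        tauto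
  · left
    obtain ⟨S, hS, hcov⟩ := exists_cover_isChain _ hc.isChain
    exact ⟨S, by omega, fun v => Or.inr (hcov v (hall v))⟩

/-- Boolean test whether every vertex of `Fin n` is in `F` or covered by `S`, in the graph with
edge list `E`. -/
def finCovers {n : ℕ} (E : List (Fin n × Fin n)) (F S : List (Fin n)) : Bool :=
  (List.finRange n).all fun v => F.contains v || S.any fun s => s == v ||
    E.any fun e => e.1 == s && (E.contains (e.2, v) || E.contains (v, e.2)) ||
      e.2 == s && (E.contains (e.1, v) || E.contains (v, e.1))

/-- The edges of the path with vertex set `Fin (n + 1)`. -/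
def pathEdges (n : ℕ) : List (Fin (n + 1) × Fin (n + 1)) :=
  (List.finRange n).map fun i => (i.castSucc, i.succ)

lemma good_of_finCovers [Fintype V] {n : ℕ} {f : Fin n → V} (hf : Function.Bijective f)
    {E : List (Fin n × Fin n)} {F S : List (Fin n)} (h : finCovers E F S = true)
    (hE : ∀ p ∈ E, G.Adj (f p.1) (f p.2)) {D : Set V} (hF : ∀ i ∈ F, f i ∈ D)
    (hS : 5 * S.length ≤ 2 * n) : G.Good D := by
  classical
  have hadj : ∀ {i j}, (E.contains (i, j) || E.contains (j, i)) = true → G.Adj (f i) (f j) := by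
    intro i j hij
    rw [Bool.or_eq_true, List.contains_iff_mem, List.contains_iff_mem] at hij
    rcases hij with h | h
    · exact hE _ h
    · exact (hE _ h).symm
  refine ⟨(S.map f).toFinset, ?_, fun v => ?_⟩
  · have h1 := (S.map f).toFinset_card_le
    have h2 := Fintype.card_of_bijective hf
    rw [List.length_map] at h1
    rw [Fintype.card_fin] at h2
    omega
  · obtain ⟨i, rfl⟩ := hf.2 v
    have hi := List.all_eq_true.1 h i (List.mem_finRange i)
    rw [Bool.or_eq_true, List.contains_iff_mem, List.any_eq_true] at hi
    rcases hi with hi | ⟨s, hs, hi⟩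
    · exact Or.inl (hF i hi)
    right
    have hsS : f s ∈ (S.map f).toFinset := List.mem_toFinset.2 (List.mem_map_of_mem hs)
    rw [Bool.or_eq_true, List.any_eq_true, beq_iff_eq] at hi
    rcases hi with rfl | ⟨e, he, hi⟩
    · exact covers_of_mem hsS
    · rw [Bool.or_eq_true, Bool.and_eq_true, Bool.and_eq_true, beq_iff_eq, beq_iff_eq] at hi
      rcases hi with ⟨rfl, hi⟩ | ⟨rfl, hi⟩
      · exact covers_of_adj hsS (hE e he) (hadj hi)
      · exact covers_of_adj hsS (hE e he).symm (hadj hi)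

/-- `G` contains a spanning eight-cycle with a pendant edge whose end is the only vertex of `D`. -/
def PendantOctagon (G : SimpleGraph V) (D : Set V) : Prop :=
  ∃ f : Fin 9 → V, Function.Bijective f ∧ (∀ i : Fin 8, G.Adj (f i.castSucc) (f i.succ)) ∧
    G.Adj (f 8) (f 1) ∧ D = {f 0}

/-- The path on nine vertices with additional edges `0 j` (if `j ≠ 0`) and `8 k` (if `k ≠ 8`). -/
def nineEdges (j k : Fin 9) : List (Fin 9 × Fin 9) :=
  pathEdges 8 ++ ((if j = 0 then [] else [(0, j)]) ++ (if k = 8 then [] else [(8, k)]))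

def nineFree (j k : Fin 9) : List (Fin 9) :=
  (if j = 0 then [0] else []) ++ (if k = 8 then [8] else [])

def nineSets : List (List (Fin 9)) :=
  [[1, 4, 5], [0, 3, 4], [2, 5, 8], [0, 1, 4], [0, 4, 7], [0, 1, 3], [1, 3, 6], [1, 2, 3],
    [1, 3, 8]]

lemma nineSets_cover : ∀ j k : Fin 9, j ≠ 1 → j ≠ 2 → k ≠ 7 → k ≠ 6 →
    (j, k) ∈ [(0, 1), (3, 1), (7, 8), (7, 5), ((7, 1) : Fin 9 × Fin 9)] ∨
      ∃ S ∈ nineSets, finCovers (nineEdges j k) (nineFree j k) S = true := by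
  decide +kernel

lemma nineSets_cover_of_free : ∀ j k : Fin 9,
    (j, k) ∈ [(0, 1), (3, 1), (7, 8), (7, 5), ((7, 1) : Fin 9 × Fin 9)] → ∀ d : Fin 9,
      (j, k, d) ∈ [(0, 1, 0), (3, 1, 0), (3, 1, 2), (7, 8, 8), (7, 5, 8), (7, 5, 6), (7, 1, 0),
        ((7, 1, 8) : Fin 9 × Fin 9 × Fin 9)] ∨
      ∃ S ∈ nineSets, finCovers (nineEdges j k) (d :: nineFree j k) S = true := by
  decide +kernel

lemma good_of_path_nine [Fintype V] (hT : G.TriFree) {D : Set V} (hD : G.TwoNbrs D)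
    {f : Fin 9 → V} (hf : Function.Bijective f)
    (hpath : ∀ i : Fin 8, G.Adj (f i.castSucc) (f i.succ)) :
    G.Good D ∨ D = ∅ ∨ G.PendantOctagon D := by
  obtain ⟨j, hj1, hj2, hj, hj0⟩ : ∃ j : Fin 9, j ≠ 1 ∧ j ≠ 2 ∧ (j ≠ 0 → G.Adj (f 0) (f j)) ∧
      (f 0 ∈ D ↔ j = 0) := by
    by_cases h0 : f 0 ∈ D
    · exact ⟨0, by decide, by decide, by simp, by simp [h0]⟩
    obtain ⟨w, hw1, hw⟩ := hD.exists_ne h0 (f 1)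
    obtain ⟨j, rfl⟩ := hf.2 w
    refine ⟨j, fun h => hw1 (h ▸ rfl), ?_, fun _ => hw, iff_of_false h0 ?_⟩
    · rintro rfl
      exact hT _ _ _ (hpath 0) (hpath 1) hw
    · rintro rfl
      exact hw.ne rfl
  obtain ⟨k, hk7, hk6, hk, hk8⟩ : ∃ k : Fin 9, k ≠ 7 ∧ k ≠ 6 ∧ (k ≠ 8 → G.Adj (f 8) (f k)) ∧
      (f 8 ∈ D ↔ k = 8) := by
    by_cases h8 : f 8 ∈ D
    · exact ⟨8, by decide, by decide, by simp, by simp [h8]⟩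
    obtain ⟨w, hw1, hw⟩ := hD.exists_ne h8 (f 7)
    obtain ⟨k, rfl⟩ := hf.2 w
    refine ⟨k, fun h => hw1 (h ▸ rfl), ?_, fun _ => hw, iff_of_false h8 ?_⟩
    · rintro rfl
      exact hT _ _ _ (hpath 7).symm (hpath 6).symm hw
    · rintro rfl
      exact hw.ne rfl
  have hE : ∀ p ∈ nineEdges j k, G.Adj (f p.1) (f p.2) := by
    intro p hp
    simp only [nineEdges, pathEdges, List.mem_append, List.mem_map] at hp
    rcases hp with ⟨i, -, rfl⟩ | hp | hp
    · exact hpath i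
    · split_ifs at hp with h
      · simp at hp
      · rw [List.mem_singleton] at hp
        exact hp ▸ hj h
    · split_ifs at hp with h
      · simp at hp
      · rw [List.mem_singleton] at hp
        exact hp ▸ hk h
  have hF : ∀ i ∈ nineFree j k, f i ∈ D := by
    intro i hi
    simp only [nineFree, List.mem_append] at hi
    rcases hi with hi | hi
    · split_ifs at hi with h
      · rw [List.mem_singleton] at hi
        exact hi ▸ hj0.2 h
      · simp at hi
    · split_ifs at hi with h
      · rw [List.mem_singleton] at hi
        exact hi ▸ hk8.2 h
      · simp at hi
  have hlen : ∀ S ∈ nineSets, 5 * S.length ≤ 2 * 9 := by decide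
  rcases nineSets_cover j k hj1 hj2 hk7 hk6 with hbad | ⟨S, hS, h⟩
  swap
  · exact Or.inl (good_of_finCovers hf h hE hF (hlen S hS))
  by_cases hgood : G.Good D
  · exact Or.inl hgood
  rcases D.eq_empty_or_nonempty with hempty | hne
  · exact Or.inr (Or.inl hempty)
  right; right
  have hfree : ∀ d, f d ∈ D → (j, k, d) ∈ [(0, 1, 0), (3, 1, 0), (3, 1, 2), (7, 8, 8), (7, 5, 8),
      (7, 5, 6), (7, 1, 0), ((7, 1, 8) : Fin 9 × Fin 9 × Fin 9)] := by
    intro d hd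
    rcases nineSets_cover_of_free j k hbad d with h | ⟨S, hS, h⟩
    · exact h
    · refine absurd (good_of_finCovers hf h hE ?_ (hlen S hS)) hgood
      intro i hi
      rcases List.mem_cons.1 hi with rfl | hi
      · exact hd
      · exact hF i hi
  have hsingle : ∀ e, (∀ d, f d ∈ D → d = e) → D = {f e} := by
    intro e he
    refine (Set.Nonempty.subset_singleton_iff hne).1 fun v hv => ?_
    obtain ⟨d, rfl⟩ := hf.2 v
    exact congrArg f (he d hv)
  have hconv : ∀ σ : Fin 9 → Fin 9, Function.Bijective σ →
      (∀ i : Fin 8, G.Adj (f (σ i.castSucc)) (f (σ i.succ))) → G.Adj (f (σ 8)) (f (σ 1)) →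
      (∀ d, f d ∈ D → d = σ 0) → G.PendantOctagon D := fun σ hσ h1 h2 h3 =>
    ⟨f ∘ σ, hf.comp hσ, h1, h2, hsingle _ h3⟩
  have h01 := hpath 0
  have h12 := hpath 1
  have h23 := hpath 2
  have h34 := hpath 3
  have h45 := hpath 4
  have h56 := hpath 5
  have h67 := hpath 6
  have h78 := hpath 7
  simp only [List.mem_cons, Prod.mk.injEq, List.not_mem_nil, or_false] at hbad
  rcases hbad with ⟨rfl, rfl⟩ | ⟨rfl, rfl⟩ | ⟨rfl, rfl⟩ | ⟨rfl, rfl⟩ | ⟨rfl, rfl⟩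
  · refine hconv id Function.bijective_id hpath (hk (by decide)) fun d hd => ?_
    have := hfree d hd
    clear hd; revert this; revert d; decide
  · refine hconv ![2, 1, 0, 3, 4, 5, 6, 7, 8] (by decide) ?_ (hk (by decide)) fun d hd => ?_
    · intro i
      fin_cases i
      exacts [h12.symm, h01.symm, hj (by decide), h34, h45, h56, h67, h78]
    · have := hfree d hd
      have : d ≠ 0 := by
        rintro rfl
        exact absurd (hj0.1 hd) (by decide)
      clear hd; revert d; decide
  · refine hconv ![8, 7, 6, 5, 4, 3, 2, 1, 0] (by decide) ?_ (hj (by decide)) fun d hd => ?_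
    · intro i
      fin_cases i
      exacts [h78.symm, h67.symm, h56.symm, h45.symm, h34.symm, h23.symm, h12.symm, h01.symm]
    · have := hfree d hd
      clear hd; revert this; revert d; decide
  · refine hconv ![6, 7, 8, 5, 4, 3, 2, 1, 0] (by decide) ?_ (hj (by decide)) fun d hd => ?_
    · intro i
      fin_cases i
      exacts [h67, h78, hk (by decide), h45.symm, h34.symm, h23.symm, h12.symm, h01.symm]
    · have := hfree d hd
      have : d ≠ 8 := by
        rintro rfl
        exact absurd (hk8.1 hd) (by decide)
      clear hd; revert d; decide
  · obtain ⟨v, hv⟩ := hne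
    obtain ⟨d, rfl⟩ := hf.2 v
    have := hfree d hv
    have h0 : d ≠ 0 := by
      rintro rfl
      exact absurd (hj0.1 hv) (by decide)
    have h8 : d ≠ 8 := by
      rintro rfl
      exact absurd (hk8.1 hv) (by decide)
    exfalso
    clear hv
    revert d
    decide

/-- A path of six vertices ending on an eight-cycle, with an additional edge `0 j` if `j ≠ 0`. -/
def fourteenEdges (j : Fin 14) : List (Fin 14 × Fin 14) :=
  pathEdges 13 ++ ([(13, 6)] ++ (if j = 0 then [] else [(0, j)]))

def fourteenSets : List (List (Fin 14)) :=
  [[1, 4, 5, 9, 10], [0, 4, 5, 9, 10], [0, 1, 5, 9, 10], [0, 1, 2, 9, 10], [0, 1, 2, 12, 13],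
    [0, 1, 2, 6, 13], [0, 1, 2, 5, 6], [0, 1, 2, 6, 7], [0, 1, 2, 7, 8]]

lemma fourteenSets_cover : ∀ j : Fin 14, j ≠ 1 → j ≠ 2 → j ≠ 7 → j ≠ 13 →
    ∃ S ∈ fourteenSets, finCovers (fourteenEdges j) (if j = 0 then [0] else []) S = true := by
  decide +kernel

lemma good_of_fourteen [Fintype V] (hT : G.TriFree) {D : Set V} (hD : G.TwoNbrs D)
    {f : Fin 14 → V} (hf : Function.Bijective f)
    (hpath : ∀ i : Fin 13, G.Adj (f i.castSucc) (f i.succ)) (hcyc : G.Adj (f 13) (f 6)) :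
    G.Good D ∨ D = ∅ := by
  have hcard : Fintype.card V = 14 := by
    rw [← Fintype.card_of_bijective hf, Fintype.card_fin]
  have hlen : ∀ S ∈ fourteenSets, 5 * S.length ≤ 2 * 14 := by decide
  have hgood : ∀ j : Fin 14, j ≠ 1 → j ≠ 2 → j ≠ 7 → j ≠ 13 → (j = 0 → f 0 ∈ D) →
      (j ≠ 0 → G.Adj (f 0) (f j)) → G.Good D := by
    intro j h1 h2 h7 h13 h0 hj
    obtain ⟨S, hS, h⟩ := fourteenSets_cover j h1 h2 h7 h13
    refine good_of_finCovers hf h ?_ ?_ (hlen S hS)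
    · intro p hp
      simp only [fourteenEdges, pathEdges, List.mem_append, List.mem_map] at hp
      rcases hp with ⟨i, -, rfl⟩ | hp | hp
      · exact hpath i
      · rw [List.mem_singleton] at hp
        exact hp ▸ hcyc
      · split_ifs at hp with h
        · simp at hp
        · rw [List.mem_singleton] at hp
          exact hp ▸ hj h
    · intro i hi
      split_ifs at hi with h
      · rw [List.mem_singleton] at hi
        exact hi ▸ h0 h
      · simp at hi
  by_cases h0 : f 0 ∈ D
  · exact Or.inl (hgood 0 (by decide) (by decide) (by decide) (by decide) (fun _ => h0) (by simp))
  obtain ⟨w, hw1, hw⟩ := hD.exists_ne h0 (f 1)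
  obtain ⟨j, rfl⟩ := hf.2 w
  have hj0 : j ≠ 0 := by
    rintro rfl
    exact hw.ne rfl
  have hj1 : j ≠ 1 := by
    rintro rfl
    exact hw1 rfl
  have hj2 : j ≠ 2 := by
    rintro rfl
    exact hT _ _ _ (hpath 0) (hpath 1) hw
  have hcycle : ∀ σ : Fin 14 → Fin 14, Function.Bijective σ →
      (∀ i : Fin 13, G.Adj (f (σ i.castSucc)) (f (σ i.succ))) → G.Adj (f (σ 13)) (f (σ 0)) →
      G.Good D ∨ D = ∅ := by
    intro σ hσ h1 h2
    have hb := hf.comp hσ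
    have hc : G.IsCyclicList (List.ofFn (f ∘ σ)) := by
      rw [List.ofFn_succ]
      refine isCyclicList_cons (y := f (σ 13)) ?_ ?_ h2
      · rw [← List.ofFn_succ, List.isChain_iff_getElem]
        intro i hi
        simp only [List.length_ofFn] at hi
        simp only [List.getElem_ofFn]
        exact h1 ⟨i, by omega⟩
      · simp [List.ofFn_succ, Fin.succ]
    rcases good_of_isCyclicList (D := D) hc (List.nodup_ofFn.2 hb.1)
      (fun v => List.mem_ofFn.2 (hb.2 v)) (by omega) with h | h
    · exact Or.inl h
    · exact Or.inr h.1
  have h0 := hpath 0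
  have h1 := hpath 1
  have h2 := hpath 2
  have h3 := hpath 3
  have h4 := hpath 4
  have h5 := hpath 5
  have h7 := hpath 7
  have h8 := hpath 8
  have h9 := hpath 9
  have h10 := hpath 10
  have h11 := hpath 11
  have h12 := hpath 12
  by_cases hj7 : j = 7
  · subst hj7
    refine hcycle ![0, 1, 2, 3, 4, 5, 6, 13, 12, 11, 10, 9, 8, 7] (by decide) ?_ hw.symm
    intro i
    fin_cases i
    exacts [h0, h1, h2, h3, h4, h5, hcyc.symm, h12.symm, h11.symm, h10.symm, h9.symm, h8.symm,
      h7.symm]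
  by_cases hj13 : j = 13
  · subst hj13
    exact hcycle id Function.bijective_id hpath hw.symm
  · exact Or.inl (hgood j hj1 hj2 hj7 hj13 (fun h => absurd h hj0) fun _ => hw)

lemma isPathList_reverse_append {B : Set V} {q x y : V} {p L : List V}
    (hp : (G.avoid B).IsPathList (y :: p)) (hy : y ∉ B) (hqy : ¬ (G.avoid B).Reachable q y)
    (hL : G.IsPathList (x :: L)) (hLB : ∀ v ∈ x :: L, v ∈ B ∨ (G.avoid B).Reachable q v)
    (hxy : G.Adj x y) : G.IsPathList ((y :: p).reverse ++ x :: L) := by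
  have hp' := hp.mono (avoid_le B)
  refine ⟨List.isChain_append.2 ⟨?_, hL.1, ?_⟩, List.nodup_append.2
    ⟨List.nodup_reverse.2 hp.2, hL.2, ?_⟩⟩
  · rw [List.isChain_reverse]
    exact hp'.1.imp fun _ _ h => h.symm
  · simp [hxy.symm]
  · rintro a ha b hb rfl
    have hr := reachable_of_isPathList hp (List.mem_reverse.1 ha)
    rcases hLB a hb with h | h
    · exact reachable_avoid_notMem hy hr h
    · exact hqy (h.trans hr.symm)

lemma covers_of_initial_path (hG : G.Connected) {D : Set V} (hD : G.TwoNbrs D)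
    {x0 x1 x2 x3 x4 q : V} {t : List V} (hl : G.IsLongest (x0 :: x1 :: x2 :: x3 :: x4 :: q :: t))
    {B : Set V} (hB : B = {x0, x1, x2, x3, x4})
    (hbranch : ∀ s, G.IsPathList (x4 :: s) → (∀ v ∈ s, ¬ (G.avoid {x4}).Reachable q v) →
      s.length < 4) [DecidableEq V] (z : V) (hzB : z ∉ B) (hzq : ¬ (G.avoid B).Reachable q z) :
    z ∈ D ∨ G.Covers {x2, x3} z ∨ G.Covers {x2, x3, x4} z ∧
      ∃ s : List V, s.Nodup ∧ s.length = 3 ∧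
        ∀ v ∈ s, v ∉ B ∧ ¬ (G.avoid B).Reachable q v := by
  by_cases hzD : z ∈ D
  · exact Or.inl hzD
  by_cases hcov : G.Covers {x2, x3} z
  · exact Or.inr (Or.inl hcov)
  right; right
  have hp := hl.1
  have hp1 := (isPathList_cons_cons.1 hp).2.2
  have hp2 := (isPathList_cons_cons.1 hp1).2.2
  have hp3 := (isPathList_cons_cons.1 hp2).2.2
  have hp4 := (isPathList_cons_cons.1 hp3).2.2
  have hp5 := (isPathList_cons_cons.1 hp4).2.2
  have h12 := (isPathList_cons_cons.1 hp1).1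
  have h23 := (isPathList_cons_cons.1 hp2).1
  have h34 := (isPathList_cons_cons.1 hp3).1
  have hqt : ∀ v ∈ q :: t, v ∉ B := by
    have := hp.2
    simp only [List.nodup_cons, List.mem_cons, not_or] at this
    intro v hv hvB
    rw [hB] at hvB
    simp only [Set.mem_insert_iff, Set.mem_singleton_iff] at hvB
    rw [List.mem_cons] at hv
    grind
  have hmem : ∀ v ∈ x0 :: x1 :: x2 :: x3 :: x4 :: q :: t, v ∈ B ∨ (G.avoid B).Reachable q v := by
    intro v hv
    by_cases h : v ∈ q :: t
    · exact Or.inr (reachable_of_isPathList (avoid_isPathList hp5 hqt) h)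
    · left
      rw [hB]
      simp only [Set.mem_insert_iff, Set.mem_singleton_iff]
      rw [List.mem_cons] at h
      simp only [List.mem_cons] at hv
      tauto
  have hout : ∀ {y}, (G.avoid B).Reachable z y → y ∉ B ∧ ¬ (G.avoid B).Reachable q y :=
    fun h => ⟨reachable_avoid_notMem hzB h, fun h' => hzq (h'.trans h.symm)⟩
  have hy0 : ∀ {y}, (G.avoid B).Reachable z y → ¬ G.Adj y x0 := fun h hadj =>
    (hmem _ (hl.mem_of_adj hadj.symm)).elim (hout h).1 (hout h).2
  have hbound : ∀ {y x p L}, (G.avoid B).Reachable z y → (G.avoid B).IsPathList (y :: p) →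
      G.IsPathList (x :: L) → (∀ v ∈ x :: L, v ∈ x0 :: x1 :: x2 :: x3 :: x4 :: q :: t) →
      G.Adj y x → p.length + L.length ≤ t.length + 4 := by
    intro y x p L hzy hyp hL hLl hyx
    have := hl.2 _ (isPathList_reverse_append hyp (hout hzy).1 (hout hzy).2 hL
      (fun v hv => hmem v (hLl v hv)) hyx.symm)
    simp only [List.length_append, List.length_reverse, List.length_cons] at this
    omega
  have hzP : ∀ {w}, G.Adj z w → w ∉ B := by
    intro w hw hwB
    have hw0 := hy0 (Reachable.refl z)
    rw [hB] at hwB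
    simp only [Set.mem_insert_iff, Set.mem_singleton_iff] at hwB
    rcases hwB with rfl | rfl | rfl | rfl | rfl
    · exact hw0 hw
    · exact hcov (covers_of_adj (s := x2) (by simp) h12.symm hw.symm)
    · exact hcov (covers_of_adj (s := x3) (by simp) h23.symm hw.symm)
    · exact hcov (covers_of_adj (s := x2) (by simp) h23 hw.symm)
    · exact hcov (covers_of_adj (s := x3) (by simp) h34 hw.symm)
  have hstep : ∀ {w}, G.Adj z w → (G.avoid B).Adj z w := fun hw => ⟨hw, hzB, hzP hw⟩
  have hpath3 : ∀ {y a}, z ≠ y → (G.avoid B).Adj y a → (G.avoid B).Adj a z →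
      (G.avoid B).IsPathList [y, a, z] := by
    intro y a hne h1 h2
    simp [isPathList_cons_cons, isPathList_singleton, h1, h2, h1.ne, h2.ne, hne.symm]
  have hpath4 : ∀ {y a w}, z ≠ y → (G.avoid B).Adj y a → (G.avoid B).Adj a z → w ≠ a → w ≠ y →
      G.Adj z w → (G.avoid B).IsPathList [y, a, z, w] := by
    intro y a w hne h1 h2 hwa hwy hzw
    simp [isPathList_cons_cons, isPathList_singleton, h1, h2, h1.ne, h2.ne, hne.symm,
      hwa.symm, hwy.symm, hstep hzw, hzw.ne]
  have hy1 : ∀ {y}, (G.avoid B).Reachable z y → ¬ G.Adj y x1 := by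
    intro y hzy hyx
    have hb : ∀ {p}, (G.avoid B).IsPathList (y :: p) → p.length ≤ 0 := fun hyp => by
      have := hbound hzy hyp hp1 (fun v hv => List.mem_cons_of_mem _ hv) hyx
      simp only [List.length_cons] at this
      omega
    rcases reach_cases hzy.symm with rfl | h | ⟨a, ha, -⟩ | ⟨a, b, h⟩ | ⟨a, b, c, d, h⟩
    · exact hzP hyx (by simp [hB])
    · simpa using hb (p := [z]) (by simp [isPathList_cons_cons, isPathList_singleton, h, h.ne])
    · simpa using hb (p := [a]) (by simp [isPathList_cons_cons, isPathList_singleton, ha, ha.ne])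
    · simpa using hb h
    · simpa using hb h
  have hy2 : ∀ {y}, (G.avoid B).Reachable z y → ¬ G.Adj y x2 := by
    intro y hzy hyx
    have hb : ∀ {p}, (G.avoid B).IsPathList (y :: p) → p.length ≤ 1 := fun hyp => by
      have := hbound hzy hyp hp2 (fun v hv => List.mem_cons_of_mem _ (List.mem_cons_of_mem _ hv)) hyx
      simp only [List.length_cons] at this
      omega
    have hzy' : z ≠ y := by
      rintro rfl
      exact hzP hyx (by simp [hB])
    rcases reach_cases hzy.symm with rfl | h | ⟨a, ha, haz⟩ | ⟨a, b, h⟩ | ⟨a, b, c, d, h⟩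
    · exact hzy' rfl
    · exact hcov (covers_of_adj (s := x2) (by simp) hyx.symm h.1)
    · simpa using hb (hpath3 hzy' ha haz)
    · simpa using hb h
    · simpa using hb h
  have hy3 : ∀ {y}, (G.avoid B).Reachable z y → ¬ G.Adj y x3 := by
    intro y hzy hyx
    have hb : ∀ {p}, (G.avoid B).IsPathList (y :: p) → p.length ≤ 2 := fun hyp => by
      have := hbound hzy hyp hp3 (fun v hv => List.mem_cons_of_mem _
        (List.mem_cons_of_mem _ (List.mem_cons_of_mem _ hv))) hyx
      simp only [List.length_cons] at this
      omega
    have hzy' : z ≠ y := by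
      rintro rfl
      exact hzP hyx (by simp [hB])
    have hyz : ¬ G.Adj y z := fun h => hcov (covers_of_adj (s := x3) (by simp) hyx.symm h)
    rcases reach_cases hzy.symm with rfl | h | ⟨a, ha, haz⟩ | ⟨a, b, h⟩ | ⟨a, b, c, d, h⟩
    · exact hzy' rfl
    · exact hyz h.1
    · obtain ⟨w, hwa, hzw⟩ := hD.exists_ne hzD a
      have hwy : w ≠ y := by
        rintro rfl
        exact hyz hzw.symm
      simpa using hb (hpath4 hzy' ha haz hwa hwy hzw)
    · simpa using hb h
    · simpa using hb h
  obtain ⟨y, hzy, x, hxB, hyx⟩ := exists_adj_of_avoid hG (b := x0) (B := B) (by simp [hB]) hzB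
  have hx : x = x4 := by
    rw [hB] at hxB
    simp only [Set.mem_insert_iff, Set.mem_singleton_iff] at hxB
    rcases hxB with rfl | rfl | rfl | rfl | rfl
    · exact absurd hyx (hy0 hzy)
    · exact absurd hyx (hy1 hzy)
    · exact absurd hyx (hy2 hzy)
    · exact absurd hyx (hy3 hzy)
    · rfl
  subst hx
  have hxB : x ∈ B := by simp [hB]
  have hnot : ∀ {v}, (G.avoid B).Reachable z v → ¬ (G.avoid {x}).Reachable q v := by
    intro v hzv hqv
    refine hzq (Reachable.symm ?_)
    refine hqv.symm.mem_of_closed (Y := {v | (G.avoid B).Reachable z v}) hzv fun a ha b hab => ?_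
    refine reachable_avoid_step hzB ha hab.1 fun hb => ?_
    rw [hB] at hb
    simp only [Set.mem_insert_iff, Set.mem_singleton_iff] at hb
    rcases hb with rfl | rfl | rfl | rfl | rfl
    · exact hy0 ha hab.1
    · exact hy1 ha hab.1
    · exact hy2 ha hab.1
    · exact hy3 ha hab.1
    · exact hab.2.2 rfl
  have hb : ∀ {p}, (G.avoid B).IsPathList (y :: p) → p.length ≤ 2 := by
    intro p hyp
    have := hbranch (y :: p) (isPathList_cons_avoid hxB (hout hzy).1 hyp hyx.symm)
      (fun v hv => hnot (hzy.trans (reachable_of_isPathList hyp hv)))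
    simp only [List.length_cons] at this
    omega
  have hzy' : z ≠ y := by
    rintro rfl
    exact hzP hyx hxB
  have hthree : ∀ {a b}, (G.avoid B).IsPathList [y, a, b] → ∃ s : List V, s.Nodup ∧ s.length = 3 ∧
      ∀ v ∈ s, v ∉ B ∧ ¬ (G.avoid B).Reachable q v := fun {a b} h =>
    ⟨[y, a, b], h.2, rfl, fun v hv => hout (hzy.trans (reachable_of_isPathList h hv))⟩
  have hadj : G.Adj y z → G.Covers {x2, x3, x} z := fun h =>
    covers_of_adj (s := x) (by simp) hyx.symm h
  rcases reach_cases hzy.symm with rfl | h | ⟨a, ha, haz⟩ | ⟨a, b, h⟩ | ⟨a, b, c, d, h⟩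
  · exact absurd rfl hzy'
  · obtain ⟨w, hwy, hzw⟩ := hD.exists_ne hzD y
    refine ⟨hadj h.1, hthree (a := z) (b := w) ?_⟩
    simp [isPathList_cons_cons, isPathList_singleton, h, hstep hzw, h.ne, hzw.ne, hwy.symm]
  · refine ⟨?_, hthree (hpath3 hzy' ha haz)⟩
    obtain ⟨w, hwa, hzw⟩ := hD.exists_ne hzD a
    by_cases hwy : w = y
    · exact hadj (hwy ▸ hzw.symm)
    · simpa using hb (hpath4 hzy' ha haz hwa hwy hzw)
  · simpa using hb h
  · simpa using hb h

/-- The conclusion of the induction: `D` can be ignored, or the graph is exceptional. -/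
def Conclusion [Fintype V] (G : SimpleGraph V) (D : Set V) : Prop :=
  G.Good D ∨ Fintype.card V = 4 ∨
    D = ∅ ∧ (Fintype.card V = 7 ∨ Fintype.card V = 8 ∨ Fintype.card V = 9 ∨ Fintype.card V = 14) ∨
    G.PendantOctagon D

/-- The conclusion holds for all graphs with fewer than `n` vertices. -/
def ConclusionBelow.{v} (n : ℕ) : Prop :=
  ∀ (W : Type v) [Fintype W] (H : SimpleGraph W) (D : Set W), H.Connected → H.TriFree →
    H.TwoNbrs D → Fintype.card W < n → H.Conclusion D

lemma conclusion_induce {n : ℕ} (ih : ConclusionBelow.{u} n) (hT : G.TriFree) (M : Finset V)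
    (hn : M.card < n) (hM : (G.induce (M : Set V)).Connected) (D : Set V)
    (hD : ∀ v ∈ M, v ∈ D ∨ ∃ a ∈ M, ∃ b ∈ M, a ≠ b ∧ G.Adj v a ∧ G.Adj v b)
    (hne : ∃ q ∈ M, q ∈ D) :
    (∃ S : Finset V, 5 * S.card ≤ 2 * M.card ∧ ∀ v ∈ M, v ∈ D ∨ G.Covers S v) ∨ M.card = 4 ∨
      ∃ f : Fin 9 → V, Function.Injective f ∧ (∀ v, v ∈ M ↔ ∃ i, f i = v) ∧
        (∀ i : Fin 8, G.Adj (f i.castSucc) (f i.succ)) ∧ G.Adj (f 8) (f 1) ∧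
        ∀ v ∈ M, v ∈ D ↔ v = f 0 := by
  classical
  have hcard : Fintype.card (M : Set V) = M.card := Fintype.card_coe M
  rcases ih (M : Set V) (G.induce (M : Set V)) (Subtype.val ⁻¹' D) hM
    (fun a b c h1 h2 h3 => hT _ _ _ h1 h2 h3) (by
      intro v hv
      rcases hD v v.2 with h | ⟨a, ha, b, hb, hab, h1, h2⟩
      · exact absurd h hv
      · exact ⟨⟨a, ha⟩, ⟨b, hb⟩, fun h => hab (congrArg Subtype.val h), h1, h2⟩)
    (hcard ▸ hn) with ⟨S, hS, hcov⟩ | h | ⟨h, -⟩ | ⟨f, hf, h1, h2, h3⟩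
  · refine Or.inl ⟨S.image Subtype.val, ?_, fun v hv => ?_⟩
    · have := Finset.card_image_le (s := S) (f := Subtype.val)
      omega
    · rcases hcov ⟨v, hv⟩ with h | ⟨s, hs, h⟩
      · exact Or.inl h
      · refine Or.inr ⟨s, Finset.mem_image_of_mem _ hs, ?_⟩
        rcases h with rfl | ⟨w, hw1, hw2⟩
        · exact Or.inl rfl
        · exact Or.inr ⟨w, hw1, hw2⟩
  · exact Or.inr (Or.inl (hcard ▸ h))
  · obtain ⟨q, hqM, hqD⟩ := hne
    have : (⟨q, hqM⟩ : (M : Set V)) ∈ (Subtype.val ⁻¹' D : Set (M : Set V)) := hqD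
    rw [h] at this
    exact this.elim
  · refine Or.inr (Or.inr ⟨fun i => f i, Subtype.val_injective.comp hf.1, fun v => ⟨fun hv => ?_, ?_⟩,
      h1, h2, fun v hv => ?_⟩)
    · obtain ⟨i, hi⟩ := hf.2 ⟨v, hv⟩
      exact ⟨i, congrArg Subtype.val hi⟩
    · rintro ⟨i, rfl⟩
      exact (f i).2
    · have := Set.ext_iff.1 h3 ⟨v, hv⟩
      rw [Set.mem_preimage, Set.mem_singleton_iff] at this
      rw [this, Subtype.ext_iff]

/-- Covers of a set and of the rest combine. -/
lemma good_of_split [Fintype V] [DecidableEq V] {D : Set V} {M A S : Finset V} {C : Set V}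
    (hM : ∀ v ∈ M, v ∈ C ∨ G.Covers S v) (hC : ∀ v ∈ C, v ∈ D ∨ G.Covers A v)
    (hU : ∀ v, v ∉ M → v ∈ D ∨ G.Covers A v)
    (hcard : 5 * (A.card + S.card) ≤ 2 * Fintype.card V) : G.Good D := by
  refine ⟨A ∪ S, ?_, fun v => ?_⟩
  · have := Finset.card_union_le A S
    omega
  · have hA : v ∈ D ∨ G.Covers A v → v ∈ D ∨ G.Covers (A ∪ S) v := fun h =>
      h.imp id fun h => h.mono Finset.subset_union_left
    by_cases hv : v ∈ M
    · rcases hM v hv with h | h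
      · exact hA (hC v h)
      · exact Or.inr (h.mono Finset.subset_union_right)
    · exact hA (hU v hv)

lemma length_le_card {M : Finset V} {l : List V} (hl : l.Nodup) (h : ∀ v ∈ l, v ∈ M) :
    l.length ≤ M.card := by
  classical
  rw [← List.toFinset_card_of_nodup hl]
  exact Finset.card_le_card fun v hv => h v (List.mem_toFinset.1 hv)

open scoped Classical in
lemma good_of_centers [Fintype V] (hG : G.Connected) {D : Set V} (hD : G.TwoNbrs D) {c : V}
    (h5 : ∀ l, G.IsPathList (c :: l) → l.length ≤ 4)
    (h4 : ∃ l, G.IsPathList (c :: l) ∧ l.length = 4) : G.Good D := by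
  have hmem : ∀ {l}, G.IsPathList (c :: l) → ∀ v ∈ l, v ∈ Finset.univ.erase c := by
    intro l hl v hv
    refine Finset.mem_erase.2 ⟨?_, Finset.mem_univ _⟩
    rintro rfl
    exact (List.nodup_cons.1 hl.2).1 hv
  obtain ⟨A, hA1, hA2, hA3, hA4⟩ := exists_centers hG hD c (Finset.univ.erase c) (by simp)
    (fun u _ w _ => by simp [em']) (fun l hl _ => h5 l hl)
  obtain ⟨l, hl, hlen⟩ := h4
  obtain ⟨a, ha⟩ := hA3 ⟨l, hl, hmem hl, hlen⟩
  have hpos : 0 < A.card := Finset.card_pos.2 ⟨a, ha⟩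
  refine ⟨insert c A, ?_, fun v => ?_⟩
  · have h1 := Finset.card_insert_le c A
    have h2 := Finset.card_erase_add_one (Finset.mem_univ c)
    rw [Finset.card_univ] at h2
    omega
  · by_cases hvc : v = c
    · exact Or.inr (covers_of_mem (by simp [hvc]))
    rcases hA4 v (by simp [hvc]) with h | h | h
    · exact Or.inl h
    · exact Or.inr (covers_of_adj (s := a) (by simp [ha]) (hA2 a ha).symm h)
    · exact Or.inr h

open scoped Classical in
lemma good_of_branch [Fintype V] (ih : ConclusionBelow.{u} (Fintype.card V)) (hG : G.Connected)
    (hT : G.TriFree) {D : Set V} (hD : G.TwoNbrs D) {c q : V} (hcq : G.Adj c q)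
    (h5 : ∀ l, G.IsPathList (c :: l) → (∀ v ∈ l, ¬ (G.avoid {c}).Reachable q v) → l.length ≤ 4)
    (h4 : ∃ l, G.IsPathList (c :: l) ∧ (∀ v ∈ l, ¬ (G.avoid {c}).Reachable q v) ∧ l.length = 4) :
    G.Good D := by
  have hqc : q ∉ ({c} : Set V) := hcq.ne'
  set M : Finset V := Finset.univ.filter fun v => (G.avoid {c}).Reachable q v with hMdef
  have hM : ∀ v, v ∈ M ↔ (G.avoid {c}).Reachable q v := fun v => by simp [hMdef]
  set U : Finset V := Mᶜ.erase c with hUdef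
  have hU : ∀ v, v ∈ U ↔ v ≠ c ∧ ¬ (G.avoid {c}).Reachable q v := fun v => by simp [hUdef, hM]
  have hcM : c ∉ M := fun h => reachable_avoid_notMem hqc ((hM c).1 h) rfl
  have hcard : M.card + U.card + 1 = Fintype.card V := by
    have h1 : U.card + 1 = Mᶜ.card := Finset.card_erase_add_one (Finset.mem_compl.2 hcM)
    have h2 : M.card + Mᶜ.card = Fintype.card V := Finset.card_add_card_compl M
    omega
  have hnotc : ∀ {l}, G.IsPathList (c :: l) → ∀ v ∈ l, v ≠ c := by
    rintro l hl v hv rfl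
    exact (List.nodup_cons.1 hl.2).1 hv
  obtain ⟨l4, hl4, hl4M, hl4len⟩ := h4
  by_cases hM4 : M.card = 4
  · refine good_of_centers hG hD (c := c) (fun l hl => ?_) ⟨l4, hl4, hl4len⟩
    match l with
    | [] => simp
    | a :: l =>
      by_cases ha : (G.avoid {c}).Reachable q a
      · rw [← hM4]
        refine length_le_card (List.nodup_cons.1 hl.2).2 fun v hv => (hM v).2 (ha.trans ?_)
        exact reachable_of_isPathList (avoid_isPathList (isPathList_cons_cons.1 hl).2.2
          fun v hv => hnotc hl v hv) hv
      · refine h5 _ hl fun v hv hqv => ha (hqv.trans (Reachable.symm ?_))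
        exact reachable_of_isPathList (avoid_isPathList (isPathList_cons_cons.1 hl).2.2
          fun v hv => hnotc hl v hv) hv
  obtain ⟨A, hA1, hA2, hA3, hA4⟩ := exists_centers hG hD c U (by simp [hUdef])
    (fun u hu w huw => by
      by_cases hwc : w = c
      · exact Or.inr hwc
      refine Or.inl ((hU w).2 ⟨hwc, fun h => ((hU u).1 hu).2 ?_⟩)
      exact reachable_avoid_step hqc h huw.symm ((hU u).1 hu).1)
    (fun l hl hlU => h5 l hl fun v hv => ((hU v).1 (hlU v hv)).2)
  obtain ⟨a, ha⟩ := hA3 ⟨l4, hl4, fun v hv => (hU v).2 ⟨hnotc hl4 v hv, hl4M v hv⟩, hl4len⟩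
  have hpos : 0 < A.card := Finset.card_pos.2 ⟨a, ha⟩
  have hNc : ∀ {v}, G.Adj c v → G.Covers (insert c A) v := fun h =>
    covers_of_adj (s := a) (by simp [ha]) (hA2 a ha).symm h
  have hins := Finset.card_insert_le c A
  rcases conclusion_induce ih hT M (by omega)
    (connected_induce_avoid hqc fun v => by rw [Finset.mem_coe, hM])
    (D ∪ {v | G.Covers (insert c A) v}) (by
      intro v hv
      by_cases hvD : v ∈ D ∪ {v | G.Covers (insert c A) v}
      · exact Or.inl hvD
      rw [Set.mem_union, not_or] at hvD
      obtain ⟨x, y, hxy, hx, hy⟩ := hD v hvD.1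
      have hstep : ∀ {w}, G.Adj v w → w ∈ M := fun hw =>
        (hM _).2 (reachable_avoid_step hqc ((hM v).1 hv) hw fun h =>
          hvD.2 (hNc ((h : _ = c) ▸ hw.symm)))
      exact Or.inr ⟨x, hstep hx, y, hstep hy, hxy, hx, hy⟩)
    ⟨q, (hM q).2 (Reachable.refl _), Or.inr (hNc hcq)⟩ with ⟨S, hS, hcov⟩ | h | h
  · refine good_of_split hcov (fun v hv => hv) (fun v hv => ?_) (by omega)
    by_cases hvc : v = c
    · exact Or.inr (covers_of_mem (by simp [hvc]))
    rcases hA4 v ((hU v).2 ⟨hvc, fun h => hv ((hM v).2 h)⟩) with h | h | h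
    · exact Or.inl h
    · exact Or.inr (hNc h)
    · exact Or.inr h
  · exact absurd h hM4
  · exfalso
    obtain ⟨f, hf, hfM, hpath, -, hfD⟩ := h
    have hq : q = f 0 := (hfD q ((hM q).2 (Reachable.refl _))).1 (Or.inr (hNc hcq))
    have h1 : f 1 = f 0 := (hfD (f 1) ((hfM _).2 ⟨1, rfl⟩)).1
      (Or.inr (covers_of_adj (s := c) (by simp) hcq (hq ▸ hpath 0)))
    exact absurd (hf h1) (by decide)

lemma inner_vertex {D : Set V} (hD : G.TwoNbrs D) {x0 x1 x2 x3 x4 q : V} {t : List V}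
    (hl : G.IsLongest (x0 :: x1 :: x2 :: x3 :: x4 :: q :: t))
    (hcyc : ¬ G.IsCyclicList (x0 :: x1 :: x2 :: x3 :: x4 :: q :: t))
    {B : Set V} (hB : B = {x0, x1, x2, x3, x4}) (hqt : ∀ v ∈ q :: t, v ∉ B) [DecidableEq V]
    (v : V) (hv : (G.avoid B).Reachable q v) :
    v ∈ D ∨ G.Covers {x2, x3} v ∨ ∃ a b, a ≠ b ∧ (G.avoid B).Reachable q a ∧
      (G.avoid B).Reachable q b ∧ G.Adj v a ∧ G.Adj v b := by
  by_cases hvD : v ∈ D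
  · exact Or.inl hvD
  by_cases hcov : G.Covers {x2, x3} v
  · exact Or.inr (Or.inl hcov)
  right; right
  have hp := hl.1
  have hp1 := (isPathList_cons_cons.1 hp).2.2
  have hp2 := (isPathList_cons_cons.1 hp1).2.2
  have hp3 := (isPathList_cons_cons.1 hp2).2.2
  have hp4 := (isPathList_cons_cons.1 hp3).2.2
  have hp5 := (isPathList_cons_cons.1 hp4).2.2
  have h12 := (isPathList_cons_cons.1 hp1).1
  have h23 := (isPathList_cons_cons.1 hp2).1
  have h34 := (isPathList_cons_cons.1 hp3).1
  have h4q := (isPathList_cons_cons.1 hp4).1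
  have hqB := hqt q (by simp)
  have hvB : v ∉ B := reachable_avoid_notMem hqB hv
  have hstep : ∀ {w}, G.Adj v w → w = x0 ∨ (G.avoid B).Reachable q w := by
    intro w hw
    by_cases hwB : w ∈ B
    · rw [hB] at hwB
      simp only [Set.mem_insert_iff, Set.mem_singleton_iff] at hwB
      rcases hwB with rfl | rfl | rfl | rfl | rfl
      · exact Or.inl rfl
      · exact absurd (covers_of_adj (s := x2) (by simp) h12.symm hw.symm) hcov
      · exact absurd (covers_of_adj (s := x3) (by simp) h23.symm hw.symm) hcov
      · exact absurd (covers_of_adj (s := x2) (by simp) h23 hw.symm) hcov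
      · exact absurd (covers_of_adj (s := x3) (by simp) h34 hw.symm) hcov
    · exact Or.inr (reachable_avoid_step hqB hv hw hwB)
  by_cases h0 : G.Adj v x0
  · have hvl : v ∈ q :: t := by
      have := hl.mem_of_adj h0.symm
      rw [hB] at hvB
      simp only [Set.mem_insert_iff, Set.mem_singleton_iff] at hvB
      simp only [List.mem_cons] at this ⊢
      tauto
    have hreach : ∀ w ∈ q :: t, (G.avoid B).Reachable q w := fun w hw =>
      reachable_of_isPathList (avoid_isPathList hp5 hqt) hw
    obtain ⟨s, r, hsr⟩ := List.append_of_mem hvl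
    have hvq : v ≠ q := by
      rintro rfl
      exact hcov (covers_of_adj (s := x3) (by simp) h34 h4q)
    rcases List.eq_nil_or_concat s with rfl | ⟨s, a, rfl⟩
    · simp only [List.nil_append, List.cons.injEq] at hsr
      exact absurd hsr.1.symm hvq
    cases r with
    | nil =>
      refine absurd (isCyclicList_cons (y := v) hp.1 ?_ h0) hcyc
      rw [hsr]
      simp [List.getLast?_cons]
    | cons b r =>
      have hp5' := hp5
      rw [hsr] at hp5' hreach
      have hch := hp5'.1
      have hnd := hp5'.2
      simp only [List.isChain_append, List.isChain_cons_cons] at hch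
      have hav : G.Adj a v := by simpa using hch.2.2
      refine ⟨a, b, ?_, hreach a (by simp), hreach b (by simp), hav.symm, hch.2.1.1⟩
      rintro rfl
      simp [List.nodup_append] at hnd
  · obtain ⟨a, b, hab, ha, hb⟩ := hD v hvD
    have hne : ∀ {w}, G.Adj v w → w ≠ x0 := fun hw e => h0 (e ▸ hw)
    exact ⟨a, b, hab, (hstep ha).resolve_left (hne ha), (hstep hb).resolve_left (hne hb), ha, hb⟩

open scoped Classical in
lemma conclusion_of_long [Fintype V] (ih : ConclusionBelow.{u} (Fintype.card V))
    (hG : G.Connected) (hT : G.TriFree) {D : Set V} (hD : G.TwoNbrs D) {x0 x1 x2 x3 x4 q : V}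
    {t : List V} (hl : G.IsLongest (x0 :: x1 :: x2 :: x3 :: x4 :: q :: t)) : G.Conclusion D := by
  by_cases hcyc : G.IsCyclicList (x0 :: x1 :: x2 :: x3 :: x4 :: q :: t)
  · have hlen := hl.1.2.length_le_card
    simp only [List.length_cons] at hlen
    rcases good_of_isCyclicList (D := D) hcyc hl.1.2 (hcyc.mem_of_isLongest hG hl (by simp))
      (by omega) with h | h
    · exact Or.inl h
    · exact Or.inr (Or.inr (Or.inl (by tauto)))
  have hp := hl.1
  have hp1 := (isPathList_cons_cons.1 hp).2.2
  have hp2 := (isPathList_cons_cons.1 hp1).2.2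
  have hp3 := (isPathList_cons_cons.1 hp2).2.2
  have hp4 := (isPathList_cons_cons.1 hp3).2.2
  have hp5 := (isPathList_cons_cons.1 hp4).2.2
  have h01 := (isPathList_cons_cons.1 hp).1
  have h12 := (isPathList_cons_cons.1 hp1).1
  have h23 := (isPathList_cons_cons.1 hp2).1
  have h34 := (isPathList_cons_cons.1 hp3).1
  have h4q := (isPathList_cons_cons.1 hp4).1
  have hext : ∀ s, G.IsPathList (x4 :: s) → (∀ v ∈ s, ¬ (G.avoid {x4}).Reachable q v) →
      s.length ≤ 4 := by
    intro s hs hsq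
    have hx4 : ∀ v ∈ q :: t, v ∉ ({x4} : Set V) := by
      rintro v hv rfl
      exact (List.nodup_cons.1 hp4.2).1 hv
    have := hl.2 (s.reverse ++ x4 :: q :: t) ⟨List.isChain_append.2 ⟨?_, hp4.1, ?_⟩,
      List.nodup_append.2 ⟨List.nodup_reverse.2 (List.nodup_cons.1 hs.2).2, hp4.2, ?_⟩⟩
    · simp only [List.length_append, List.length_reverse, List.length_cons] at this
      omega
    · rw [List.isChain_reverse]
      exact hs.1.tail.imp fun _ _ h => h.symm
    · cases s with
      | nil => simp
      | cons a s => simpa using (isPathList_cons_cons.1 hs).1.symm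
    · rintro a ha b hb rfl
      rw [List.mem_reverse] at ha
      rcases List.mem_cons.1 hb with rfl | hb
      · exact (List.nodup_cons.1 hs.2).1 ha
      · exact hsq a ha (reachable_of_isPathList (avoid_isPathList hp5 hx4) hb)
  by_cases hbr : ∃ s, G.IsPathList (x4 :: s) ∧ (∀ v ∈ s, ¬ (G.avoid {x4}).Reachable q v) ∧
      s.length = 4
  · exact Or.inl (good_of_branch ih hG hT hD h4q hext hbr)
  have hbranch : ∀ s, G.IsPathList (x4 :: s) → (∀ v ∈ s, ¬ (G.avoid {x4}).Reachable q v) →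
      s.length < 4 := fun s hs hsq =>
    lt_of_le_of_ne (hext s hs hsq) fun h => hbr ⟨s, hs, hsq, h⟩
  obtain ⟨B, hB⟩ : ∃ B : Set V, B = {x0, x1, x2, x3, x4} := ⟨_, rfl⟩
  have hBmem : ∀ v, v ∈ B ↔ v ∈ [x0, x1, x2, x3, x4] := by simp [hB]
  have hnd5 : [x0, x1, x2, x3, x4].Nodup ∧ ∀ v ∈ q :: t, v ∉ [x0, x1, x2, x3, x4] := by
    have h : ([x0, x1, x2, x3, x4] ++ q :: t).Nodup := hp.2
    rw [List.nodup_append] at h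
    exact ⟨h.1, fun v hv hv' => h.2.2 v hv' v hv rfl⟩
  have hqt : ∀ v ∈ q :: t, v ∉ B := fun v hv h => hnd5.2 v hv ((hBmem v).1 h)
  have hqB := hqt q (by simp)
  set M : Finset V := Finset.univ.filter fun v => (G.avoid B).Reachable q v with hMdef
  have hM : ∀ v, v ∈ M ↔ (G.avoid B).Reachable q v := fun v => by simp [hMdef]
  have hqM : q ∈ M := (hM q).2 (Reachable.refl _)
  have hMB : ∀ v ∈ M, v ∉ B := fun v hv => reachable_avoid_notMem hqB ((hM v).1 hv)
  have hcard : M.card + Mᶜ.card = Fintype.card V := Finset.card_add_card_compl M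
  have hBM : ∀ v ∈ [x0, x1, x2, x3, x4], v ∈ Mᶜ := fun v hv =>
    Finset.mem_compl.2 fun h => hMB v h ((hBmem v).2 hv)
  have hP5 : 5 ≤ Mᶜ.card := length_le_card hnd5.1 hBM
  have hx4P : ∀ {v}, G.Adj x4 v → G.Covers {x2, x3} v := fun h =>
    covers_of_adj (s := x3) (by simp) h34 h
  have hsub : ({x2, x3} : Finset V) ⊆ {x2, x3, x4} :=
    Finset.insert_subset_insert _ (Finset.singleton_subset_iff.2 (by simp))
  have hP : ∀ v, v ∉ M → v ∈ D ∨ G.Covers {x2, x3} v ∨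
      G.Covers {x2, x3, x4} v ∧ 8 ≤ Mᶜ.card := by
    intro v hv
    by_cases hvB : v ∈ B
    · right; left
      rw [hB] at hvB
      simp only [Set.mem_insert_iff, Set.mem_singleton_iff] at hvB
      rcases hvB with rfl | rfl | rfl | rfl | rfl
      · exact covers_of_adj (s := x2) (by simp) h12.symm h01.symm
      · exact covers_of_adj (s := x3) (by simp) h23.symm h12.symm
      · exact covers_of_mem (by simp)
      · exact covers_of_mem (by simp)
      · exact covers_of_adj (s := x2) (by simp) h23 h34
    · rcases covers_of_initial_path hG hD hl hB hbranch v hvB (fun h => hv ((hM v).2 h)) with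
        h | h | ⟨h, s, hs1, hs2, hs3⟩
      · exact Or.inl h
      · exact Or.inr (Or.inl h)
      · refine Or.inr (Or.inr ⟨h, ?_⟩)
        have : ([x0, x1, x2, x3, x4] ++ s).length ≤ Mᶜ.card := by
          refine length_le_card (List.nodup_append.2 ⟨hnd5.1, hs1, ?_⟩) fun v hv => ?_
          · rintro a ha b hb rfl
            exact (hs3 a hb).1 ((hBmem a).2 ha)
          · rcases List.mem_append.1 hv with h | h
            · exact hBM v h
            · exact Finset.mem_compl.2 fun h' => (hs3 v h).2 ((hM v).1 h')
        rw [List.length_append, hs2] at this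
        exact this
  have hP3 : ∀ v, v ∉ M → v ∈ D ∨ G.Covers {x2, x3, x4} v := fun v hv => by
    rcases hP v hv with h | h | h
    · exact Or.inl h
    · exact Or.inr (h.mono hsub)
    · exact Or.inr h.1
  have hinner : ∀ v ∈ M, v ∈ D ∨ G.Covers {x2, x3} v ∨
      ∃ a ∈ M, ∃ b ∈ M, a ≠ b ∧ G.Adj v a ∧ G.Adj v b := fun v hv => by
    rcases inner_vertex hD hl hcyc hB hqt v ((hM v).1 hv) with h | h | ⟨a, b, hab, ha, hb, h⟩
    · exact Or.inl h
    · exact Or.inr (Or.inl h)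
    · exact Or.inr (Or.inr ⟨a, (hM a).2 ha, b, (hM b).2 hb, hab, h⟩)
  have hinner_ne : ∀ v ∈ M, ∀ a, v ∈ D ∨ G.Covers {x2, x3} v ∨ ∃ b ∈ M, b ≠ a ∧ G.Adj v b := by
    intro v hv a
    rcases hinner v hv with h | h | ⟨b, hb, c, hc, hbc, h1, h2⟩
    · exact Or.inl h
    · exact Or.inr (Or.inl h)
    · refine Or.inr (Or.inr ?_)
      by_cases h : b = a
      · exact ⟨c, hc, fun h' => hbc (h.trans h'.symm), h2⟩
      · exact ⟨b, hb, h, h1⟩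
  have hind := fun (A : Finset V) (hA : {x2, x3} ⊆ A) =>
    conclusion_induce ih hT M (by omega)
      (connected_induce_avoid hqB fun v => by rw [Finset.mem_coe, hM])
      (D ∪ {v | G.Covers A v})
      (fun v hv => by
        rcases hinner v hv with h | h | h
        · exact Or.inl (Or.inl h)
        · exact Or.inl (Or.inr (h.mono hA))
        · exact Or.inr h)
      ⟨q, hqM, Or.inr ((hx4P h4q).mono hA)⟩
  have hreachM : ∀ {p}, (G.avoid B).IsPathList (q :: p) → ∀ v ∈ q :: p, v ∈ M := fun hp v hv =>
    (hM v).2 (reachable_of_isPathList hp hv)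
  have hpl : ∀ {p}, (G.avoid B).IsPathList (q :: p) → p.length ≤ t.length := fun {p} hp => by
    have hqp : ∀ v ∈ q :: p, v ∉ B := fun v hv => hMB v (hreachM hp v hv)
    have := hl.2 ([x0, x1, x2, x3, x4] ++ q :: p) ⟨?_, List.nodup_append.2 ⟨hnd5.1, hp.2, ?_⟩⟩
    · simp only [List.length_append, List.length_cons] at this
      omega
    · simpa [h01, h12, h23, h34, h4q] using (hp.mono (avoid_le B)).1
    · rintro a ha b hb rfl
      exact hqp a hb ((hBmem a).2 ha)
  by_cases hM4 : M.card = 4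
  · have hstar : ∀ v ∈ M, (∃ a b, (G.avoid B).IsPathList [q, a, b, v]) →
        v ∈ D ∨ G.Covers {x2, x3, x4} v ∨ G.Covers {q} v := by
      rintro v hv ⟨a, b, h⟩
      rcases hinner_ne v hv b with h' | h' | ⟨w, hw, hwb, hvw⟩
      · exact Or.inl h'
      · exact Or.inr (Or.inl (h'.mono hsub))
      right
      by_cases hwq : w = q
      · exact Or.inl (covers_of_adj (s := x4) (by simp) h4q (hwq ▸ hvw.symm))
      by_cases hwa : w = a
      · exact Or.inr (covers_of_adj (s := q) (by simp) (isPathList_cons_cons.1 h).1.1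
          (hwa ▸ hvw.symm))
      exfalso
      have hlen : (w :: [q, a, b, v]).length ≤ M.card := by
        refine length_le_card (List.nodup_cons.2 ⟨?_, h.2⟩) fun u hu => ?_
        · simp [hwq, hwa, hwb, hvw.ne']
        · rcases List.mem_cons.1 hu with rfl | hu
          · exact hw
          · exact hreachM h u hu
      simp [hM4] at hlen
    have hno5 : ∀ {a b c d}, ¬ (G.avoid B).IsPathList [q, a, b, c, d] := fun h => by
      have := length_le_card h.2 (hreachM h)
      simp [hM4] at this
    by_cases hP6 : 6 ≤ Mᶜ.card
    · refine Or.inl (good_of_split (M := M) (A := {x2, x3, x4}) (S := {q}) (C := D ∪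
        {v | G.Covers {x2, x3, x4} v}) (fun v hv => ?_) (fun v hv => hv) hP3 ?_)
      · rw [Set.mem_union, Set.mem_ofPred_eq, or_assoc]
        rcases reach_cases ((hM v).1 hv) with rfl | h | ⟨a, ha, hav⟩ | h | ⟨a, b, c, d, h⟩
        · exact Or.inr (Or.inr (covers_of_mem (by simp)))
        · exact Or.inr (Or.inl (covers_of_adj (s := x4) (by simp) h4q h.1))
        · exact Or.inr (Or.inr (covers_of_adj (s := q) (by simp) ha.1 hav.1))
        · exact hstar v hv h
        · exact absurd h hno5
      · have h1 := Finset.card_le_three (a := x2) (b := x3) (c := x4)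
        rw [Finset.card_singleton]
        omega
    · have ht : t.length ≤ 3 := by
        have := length_le_card hp5.2 (hreachM (avoid_isPathList hp5 hqt))
        rw [hM4, List.length_cons] at this
        omega
      rcases ht.eq_or_lt with ht | ht
      · obtain ⟨a, b, c, rfl⟩ := List.length_eq_three.1 ht
        have hinj : Function.Injective ![x0, x1, x2, x3, x4, q, a, b, c] := by
          have h : (List.ofFn ![x0, x1, x2, x3, x4, q, a, b, c]).Nodup := by
            simpa [List.ofFn_succ] using hp.2
          exact List.nodup_ofFn.1 h
        have hcard9 : Fintype.card V = 9 := by omega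
        have hbij := (Fintype.bijective_iff_injective_and_card _).2
          ⟨hinj, by rw [hcard9, Fintype.card_fin]⟩
        have hch := hp5.1
        simp only [List.isChain_cons_cons, List.isChain_singleton, and_true] at hch
        rcases good_of_path_nine hT hD hbij (fun i => by
          fin_cases i
          exacts [h01, h12, h23, h34, h4q, hch.1, hch.2.1, hch.2.2]) with h | h | h
        · exact Or.inl h
        · exact Or.inr (Or.inr (Or.inl ⟨h, by simp [hcard9]⟩))
        · exact Or.inr (Or.inr (Or.inr h))
      have hno4 : ∀ {a b c}, ¬ (G.avoid B).IsPathList [q, a, b, c] := fun h => by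
        have := hpl h
        simp only [List.length_cons, List.length_nil] at this
        omega
      obtain ⟨y, hqy⟩ : ∃ y, (G.avoid B).Adj q y := by
        obtain ⟨z, hz, hzq⟩ := Finset.exists_mem_ne (by omega : 1 < M.card) q
        rcases reach_cases ((hM z).1 hz) with h | h | ⟨a, ha, -⟩ | ⟨a, b, h⟩ | ⟨a, b, c, d, h⟩
        · exact absurd h hzq
        · exact ⟨z, h⟩
        · exact ⟨a, ha⟩
        · exact absurd h hno4
        · exact absurd h hno5
      refine Or.inl (good_of_split (M := M) (A := {x2, x3}) (S := {y}) (C := D ∪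
        {v | G.Covers {x2, x3} v}) (fun v hv => ?_) (fun v hv => hv) (fun v hv => ?_) ?_)
      · rw [Set.mem_union, Set.mem_ofPred_eq, or_assoc]
        have hqv : G.Adj q v → G.Covers {y} v :=
          fun h => covers_of_adj (s := y) (by simp) hqy.1.symm h
        rcases reach_cases ((hM v).1 hv) with rfl | h | ⟨a, ha, hav⟩ | ⟨a, b, h⟩ | ⟨a, b, c, d, h⟩
        · exact Or.inr (Or.inl (hx4P h4q))
        · exact Or.inr (Or.inr (hqv h.1))
        · rcases hinner_ne v hv a with h' | h' | ⟨w, hw, hwa, hvw⟩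
          · exact Or.inl h'
          · exact Or.inr (Or.inl h')
          by_cases hwq : w = q
          · exact Or.inr (Or.inr (hqv (hwq ▸ hvw.symm)))
          by_cases hvq : v = q
          · exact Or.inr (Or.inl (hvq ▸ hx4P h4q))
          refine absurd ⟨?_, ?_⟩ (hno4 (a := a) (b := v) (c := w))
          · simp only [List.isChain_cons_cons, List.isChain_singleton, and_true]
            exact ⟨ha, hav, hvw, hMB v hv, hMB w hw⟩
          · simp [ha.ne, hav.ne, hvw.ne, Ne.symm hwa, Ne.symm hwq, Ne.symm hvq]
        · exact absurd h hno4
        · exact absurd h hno5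
      · exact (hP v hv).imp id fun h => h.resolve_right fun h => by omega
      · have := Finset.card_le_two (a := x2) (b := x3)
        rw [Finset.card_singleton]
        omega
  have hbig : ∀ k, (∀ S : Finset V, 5 * S.card ≤ 2 * M.card → S.card ≤ k) →
      5 * (3 + k) ≤ 2 * Fintype.card V → G.Good D := by
    intro k hk hcardk
    have hA := Finset.card_le_three (a := x2) (b := x3) (c := x4)
    rcases hind {x2, x3, x4} hsub with ⟨S, hS, hcov⟩ | h | ⟨f, hf, hfM, hpath, -, hfD⟩
    · have := hk S hS
      exact good_of_split hcov (fun v hv => hv) hP3 (by omega)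
    · exact absurd h hM4
    · exfalso
      have hq : q = f 0 := (hfD q hqM).1 (Or.inr ((hx4P h4q).mono hsub))
      have h1 : f 1 = f 0 := (hfD (f 1) ((hfM _).2 ⟨1, rfl⟩)).1
        (Or.inr (covers_of_adj (s := x4) (by simp) h4q (hq ▸ hpath 0)))
      exact absurd (hf h1) (by decide)
  by_cases hP8 : 8 ≤ Mᶜ.card
  · exact Or.inl (hbig (2 * M.card / 5) (fun S hS => by omega) (by omega))
  have hA := Finset.card_le_two (a := x2) (b := x3)
  rcases hind {x2, x3} (Finset.Subset.refl _) with ⟨S, hS, hcov⟩ | h | ⟨f, hf, hfM, hpath, hf8, hfD⟩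
  · exact Or.inl (good_of_split hcov (fun v hv => hv)
      (fun v hv => (hP v hv).imp id fun h => h.resolve_right fun h => hP8 h.2) (by omega))
  · exact absurd h hM4
  have hM9 : M.card = 9 := by
    have : M = Finset.univ.image f := by
      ext v
      simp [hfM]
    rw [this, Finset.card_image_of_injective _ hf, Finset.card_univ, Fintype.card_fin]
  by_cases hP6 : 6 ≤ Mᶜ.card
  · exact Or.inl (hbig 3 (fun S hS => by omega) (by omega))
  have hq : q = f 0 := (hfD q hqM).1 (Or.inr (hx4P h4q))
  have hcard14 : Fintype.card V = 14 := by omega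
  have hBeq : [x0, x1, x2, x3, x4].toFinset = Mᶜ :=
    Finset.eq_of_subset_of_card_le (fun v hv => hBM v (List.mem_toFinset.1 hv)) (by
      rw [List.toFinset_card_of_nodup hnd5.1]
      simp only [List.length_cons, List.length_nil]
      omega)
  have hbij : Function.Bijective
      ![x0, x1, x2, x3, x4, f 0, f 1, f 2, f 3, f 4, f 5, f 6, f 7, f 8] := by
    refine (Fintype.bijective_iff_surjective_and_card _).2
      ⟨fun v => ?_, by rw [hcard14, Fintype.card_fin]⟩
    by_cases hv : v ∈ M
    · obtain ⟨i, rfl⟩ := (hfM v).1 hv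
      refine ⟨i.natAdd 5, ?_⟩
      fin_cases i <;> rfl
    · rw [← Finset.mem_compl, ← hBeq, List.mem_toFinset] at hv
      simp only [List.mem_cons, List.not_mem_nil, or_false] at hv
      rcases hv with rfl | rfl | rfl | rfl | rfl
      exacts [⟨0, rfl⟩, ⟨1, rfl⟩, ⟨2, rfl⟩, ⟨3, rfl⟩, ⟨4, rfl⟩]
  rcases good_of_fourteen hT hD hbij (fun i => by
    fin_cases i
    exacts [h01, h12, h23, h34, hq ▸ h4q, hpath 0, hpath 1, hpath 2, hpath 3, hpath 4, hpath 5,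
      hpath 6, hpath 7]) hf8 with h | h
  · exact Or.inl h
  · exact Or.inr (Or.inr (Or.inl ⟨h, by simp [hcard14]⟩))

theorem conclusionBelow (n : ℕ) : ConclusionBelow.{u} n := by
  induction n with
  | zero => exact fun _ _ _ _ _ _ _ h => absurd h (Nat.not_lt_zero _)
  | succ n ih =>
    intro V _ G D hG hT hD hn
    have ih' : ConclusionBelow.{u} (Fintype.card V) := fun W _ H D h1 h2 h3 h4 =>
      ih W H D h1 h2 h3 (by omega)
    obtain ⟨l, hl⟩ := G.exists_isLongest
    by_cases h4 : l.length ≤ 4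
    · exact (good_of_length_le_four hG hT hD hl h4).imp id Or.inl
    match l with
    | [] | [_] | [_, _] | [_, _, _] | [_, _, _, _] => simp at h4
    | [x0, x1, x2, x3, x4] =>
      refine Or.inl (good_of_centers hG hD (c := x4) (fun l h => ?_) ⟨[x3, x2, x1, x0], ?_, rfl⟩)
      · have := hl.2 _ h
        simp only [List.length_cons, List.length_nil] at this
        omega
      · refine ⟨?_, List.nodup_reverse.2 hl.1.2⟩
        exact (List.isChain_reverse (l := [x0, x1, x2, x3, x4])).2 (hl.1.1.imp fun _ _ h => h.symm)
    | x0 :: x1 :: x2 :: x3 :: x4 :: q :: t => exact conclusion_of_long ih' hG hT hD hl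

lemma good_of_two_le_minDegree [Fintype V] [DecidableRel G.Adj] (hG : G.Connected)
    (hT : G.TriFree) (hn : 15 ≤ Fintype.card V) (hδ : 2 ≤ G.minDegree) : G.Good ∅ := by
  have hD : G.TwoNbrs ∅ := fun v _ => by
    have h : 1 < (G.neighborFinset v).card := hδ.trans (G.minDegree_le_degree v)
    obtain ⟨a, ha, b, hb, hab⟩ := Finset.one_lt_card.1 h
    exact ⟨a, b, hab, (G.mem_neighborFinset _ _).1 ha, (G.mem_neighborFinset _ _).1 hb⟩
  rcases conclusionBelow _ V G ∅ hG hT hD (Nat.lt_succ_self _) with h | h | ⟨-, h⟩ | ⟨f, -, -, -, h⟩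
  · exact h
  · omega
  · omega
  · exact absurd (h ▸ Set.mem_singleton (f 0)) (Set.notMem_empty _)

lemma TriFree.dist_eq_two (hT : G.TriFree) {s w v : V} (hsv : s ≠ v) (hsw : G.Adj s w)
    (hwv : G.Adj w v) : G.dist s v = 2 := by
  have h2 : G.dist s v ≤ 2 := G.dist_le (Walk.cons hsw (Walk.cons hwv Walk.nil))
  have h1 : G.dist s v ≠ 1 := fun h => hT _ _ _ hsw hwv (dist_eq_one_iff_adj.1 h)
  have h0 : 0 < G.dist s v := (hsw.reachable.trans hwv.reachable).pos_dist_of_ne hsv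
  omega

lemma Good.hopDominationNumber_le [Fintype V] (hT : G.TriFree) (h : G.Good ∅) :
    5 * G.hopDominationNumber ≤ 2 * Fintype.card V := by
  obtain ⟨S, hS, hcov⟩ := h
  have hle : G.hopDominationNumber ≤ S.card := by
    refine Nat.sInf_le ⟨S, fun v hv => ?_, rfl⟩
    obtain ⟨s, hs, h⟩ := (hcov v).resolve_left (Set.notMem_empty v)
    have hsv : s ≠ v := fun h => hv (h ▸ hs)
    obtain ⟨w, hsw, hwv⟩ := h.resolve_left hsv
    exact ⟨s, hs, hT.dist_eq_two hsv hsw hwv⟩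
  omega

lemma CliqueFree.triFree (h : G.CliqueFree 3) : G.TriFree := by
  classical
  exact fun a b c hab hbc hac => h {a, b, c} (is3Clique_triple_iff.2 ⟨hab, hac, hbc⟩)

end SimpleGraph

theorem hop_domination_le_two_fifths {V : Type*} [Fintype V] (G : SimpleGraph V)
    [DecidableRel G.Adj] (hconn : G.Connected) (htf : G.CliqueFree 3)
    (hn : 15 ≤ Fintype.card V) (hδ : 2 ≤ G.minDegree) :
    5 * G.hopDominationNumber ≤ 2 * Fintype.card V :=
  (SimpleGraph.good_of_two_le_minDegree hconn htf.triFree hn hδ).hopDominationNumber_le htf.triFree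
end

section
/- Let m ≥ 1 and let a_1, …, a_m be integers with each a_i ≥ 4. Let G be the triangle-free graph C(a_1,…,a_m) on n vertices obtained from m vertex-disjoint cycles of lengths a_1, …, a_m by identifying one vertex from each cycle into a single vertex v (so every pair of these cycles meets exactly in v and their union is G). If G is not isomorphic to any of C_4, C_7, C_8, C_14, then there exists a hop dominating set S of G with v ∈ S and |S| ≤ 2n/5 (i.e., 5·|S| ≤ 2n); in particular γ_h(G) ≤ 2n/5. -/
/-- `G` is the graph `C(a₁,…,aₘ)` with common vertex `v`: there are `m` cycles through `v`,
the `i`-th of length `a i`, pairwise meeting only in `v`, covering all vertices and edges. -/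
def IsCycleBouquet {V : Type*} (G : SimpleGraph V) (v : V) {m : ℕ} (a : Fin m → ℕ) : Prop :=
  ∃ p : ∀ _ : Fin m, G.Walk v v,
    (∀ i, (p i).IsCycle) ∧
    (∀ i, (p i).length = a i) ∧
    (∀ i j, i ≠ j → ∀ x, x ∈ (p i).support → x ∈ (p j).support → x = v) ∧
    (∀ x : V, ∃ i, x ∈ (p i).support) ∧
    (∀ e ∈ G.edgeSet, ∃ i, e ∈ (p i).edges)

open Finset

namespace CycleBouquet

/-- Position `x` of a cycle of length `a`, whose positions are numbered `0, …, a - 1`, is at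
cyclic distance two from position `0` or from a position in `T`. -/
def HopCovered (a : ℕ) (T : Finset ℕ) (x : ℕ) : Prop :=
  x = 2 ∨ x + 2 = a ∨ x + 2 ∈ T ∨ (∃ y ∈ T, x = y + 2) ∨ (x = 1 ∧ a - 1 ∈ T) ∨
    (x + 1 = a ∧ 1 ∈ T)

/-- The second residue class modulo `6` used in `fullPositions`. -/
def residue (a : ℕ) : ℕ := if a % 2 = 0 then 1 else 6 - a % 6

/-- Positions which together with position `0` hop dominate a cycle of length `a`. -/
def fullPositions (a : ℕ) : Finset ℕ :=
  (range a).filter fun x => 0 < x ∧ (x % 6 = 0 ∨ x % 6 = residue a)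

/-- For `a ∈ {4, 8, 14}`, positions which together with position `0` hop dominate every position
of a cycle of length `a` not adjacent to position `0`. -/
def relaxedPositions (a : ℕ) : Finset ℕ :=
  if a = 8 then {3, 4} else if a = 14 then {5, 6, 8, 9} else ∅

/-- The contribution of a cycle of length `a` to `2 * n - 5 * |S|`. -/
def surplus (a : ℕ) (T : Finset ℕ) : ℤ := 2 * ((a : ℤ) - 1) - 5 * (T.card : ℤ)

lemma mem_fullPositions {a x : ℕ} :
    x ∈ fullPositions a ↔ x < a ∧ 0 < x ∧ (x % 6 = 0 ∨ x % 6 = residue a) := by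
  simp [fullPositions]

lemma card_fullPositions_le {a : ℕ} :
    (fullPositions a).card ≤ (a - 1) / 6 + (a + 5 - residue a) / 6 := by
  have hsub : fullPositions a ⊆ (range ((a - 1) / 6)).image (fun t => 6 * t + 6) ∪
      (range ((a + 5 - residue a) / 6)).image (fun t => 6 * t + residue a) := by
    intro x hx
    obtain ⟨hxa, hx0, h | h⟩ := mem_fullPositions.1 hx
    · refine mem_union_left _ (mem_image.2 ⟨x / 6 - 1, mem_range.2 (by omega), by omega⟩)
    · refine mem_union_right _ (mem_image.2 ⟨x / 6, mem_range.2 ?_, by omega⟩)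
      omega
  refine (card_le_card hsub).trans ((card_union_le _ _).trans ?_)
  exact add_le_add (card_image_le.trans (card_range _).le) (card_image_le.trans (card_range _).le)

lemma fullPositions_covers {a x : ℕ} (ha : 4 ≤ a) (hx0 : 0 < x) (hxa : x < a) :
    x ∈ fullPositions a ∨ HopCovered a (fullPositions a) x := by
  have hback : (∃ y ∈ fullPositions a, x = y + 2) ↔ 2 ≤ x ∧ x - 2 ∈ fullPositions a :=
    ⟨fun ⟨y, hy, h⟩ => ⟨by omega, by rwa [h, Nat.add_sub_cancel]⟩,
      fun h => ⟨x - 2, h.2, by omega⟩⟩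
  rw [HopCovered, hback]
  have hx : x % 6 = 0 ∨ x % 6 = 1 ∨ x % 6 = 2 ∨ x % 6 = 3 ∨ x % 6 = 4 ∨ x % 6 = 5 := by omega
  simp only [mem_fullPositions, residue]
  split_ifs <;> rcases hx with hx | hx | hx | hx | hx | hx <;> omega

lemma relaxedPositions_covers {a x : ℕ} (ha : a = 4 ∨ a = 8 ∨ a = 14) (hx0 : 1 < x)
    (hxa : x + 1 < a) : x ∈ relaxedPositions a ∨ HopCovered a (relaxedPositions a) x := by
  replace hxa := Nat.lt_sub_of_add_lt hxa
  rcases ha with rfl | rfl | rfl <;> norm_num only at hxa <;> interval_cases x <;>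
    simp [relaxedPositions, HopCovered]

lemma fullPositions_neighbor {a : ℕ} (ha : 4 ≤ a) (h : a % 6 ≠ 3) :
    1 ∈ fullPositions a ∨ a - 1 ∈ fullPositions a := by
  simp only [mem_fullPositions, residue]
  split_ifs <;> omega

lemma le_surplus_fullPositions {a : ℕ} :
    2 * ((a : ℤ) - 1) - 5 * (((a - 1) / 6 + (a + 5 - residue a) / 6 : ℕ) : ℤ) ≤
      surplus a (fullPositions a) := by
  have := card_fullPositions_le (a := a)
  unfold surplus
  omega

lemma surplus_fullPositions {a : ℕ} (ha : 4 ≤ a) :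
    -1 ≤ surplus a (fullPositions a) ∧
    (a ≠ 4 ∧ a ≠ 8 ∧ a ≠ 14 → 2 ≤ surplus a (fullPositions a)) ∧
    (a ≠ 4 ∧ a ≠ 7 ∧ a ≠ 8 ∧ a ≠ 14 → 3 ≤ surplus a (fullPositions a)) ∧
    (a % 6 = 3 → 4 ≤ surplus a (fullPositions a)) := by
  have h := le_surplus_fullPositions (a := a)
  unfold residue at h
  split_ifs at h <;> omega

lemma surplus_relaxedPositions {a : ℕ} (ha : a = 4 ∨ a = 8 ∨ a = 14) :
    4 ≤ surplus a (relaxedPositions a) := by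
  rcases ha with rfl | rfl | rfl <;> simp [relaxedPositions, surplus]

lemma add_le_sum_of_nonneg {ι : Type*} [Fintype ι] [DecidableEq ι] (f : ι → ℤ) {i j : ι}
    (hij : j ≠ i) (hf : ∀ k, k ≠ i → 0 ≤ f k) : f i + f j ≤ ∑ k, f k := by
  rw [← add_sum_erase univ f (mem_univ i)]
  gcongr
  exact single_le_sum (fun k hk => hf k (ne_of_mem_erase hk)) (mem_erase.2 ⟨hij, mem_univ j⟩)

/-- Choice of positions on each cycle of a bouquet. -/
lemma exists_positions {m : ℕ} (hm : 1 ≤ m) (a : Fin m → ℕ) (ha : ∀ i, 4 ≤ a i)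
    (hone : m = 1 → ∀ i, a i ≠ 4 ∧ a i ≠ 7 ∧ a i ≠ 8 ∧ a i ≠ 14) :
    ∃ T : Fin m → Finset ℕ, (∀ i, ∀ x ∈ T i, 0 < x ∧ x < a i) ∧
      (∀ i x, 0 < x → x < a i → x ∈ T i ∨ HopCovered (a i) (T i) x ∨
        ((x = 1 ∨ x = a i - 1) ∧ ∃ j, j ≠ i ∧ (1 ∈ T j ∨ a j - 1 ∈ T j))) ∧
      3 ≤ ∑ i, surplus (a i) (T i) := by
  have hfull : ∀ i, ∀ x ∈ fullPositions (a i), 0 < x ∧ x < a i := fun i x hx =>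
    ⟨(mem_fullPositions.1 hx).2.1, (mem_fullPositions.1 hx).1⟩
  have hother : m ≠ 1 → ∀ i : Fin m, ∃ j, j ≠ i := fun h i => by
    have : Nontrivial (Fin m) := Fin.nontrivial_iff_two_le.2 (by omega)
    exact exists_ne i
  by_cases hB : ∃ b, a b = 4 ∨ a b = 8 ∨ a b = 14
  · obtain ⟨b, hb⟩ := hB
    have hm1 : m ≠ 1 := fun h => by have := hone h b; omega
    have key : ∀ i₀ : Fin m, a i₀ % 6 ≠ 3 →
        (∃ j, j ≠ i₀ ∧
          3 ≤ surplus (a i₀) (fullPositions (a i₀)) + surplus (a j)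
            (if a j = 4 ∨ a j = 8 ∨ a j = 14 then relaxedPositions (a j)
              else fullPositions (a j))) →
        ∃ T : Fin m → Finset ℕ, (∀ i, ∀ x ∈ T i, 0 < x ∧ x < a i) ∧
          (∀ i x, 0 < x → x < a i → x ∈ T i ∨ HopCovered (a i) (T i) x ∨
            ((x = 1 ∨ x = a i - 1) ∧ ∃ j, j ≠ i ∧ (1 ∈ T j ∨ a j - 1 ∈ T j))) ∧
          3 ≤ ∑ i, surplus (a i) (T i) := by
      rintro i₀ hi₀ ⟨j, hj, hsum⟩
      set T : Fin m → Finset ℕ := fun i =>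
        if i ≠ i₀ ∧ (a i = 4 ∨ a i = 8 ∨ a i = 14) then relaxedPositions (a i)
        else fullPositions (a i) with hT
      have hTi₀ : T i₀ = fullPositions (a i₀) := by simp [hT]
      refine ⟨T, fun i x hx => ?_, fun i x hx0 hxa => ?_, ?_⟩
      · simp only [hT] at hx
        split_ifs at hx with hc
        · obtain ⟨-, h | h | h⟩ := hc <;> simp [relaxedPositions, h] at hx <;> omega
        · exact hfull i x hx
      · by_cases hc : i ≠ i₀ ∧ (a i = 4 ∨ a i = 8 ∨ a i = 14)
        · have hTi : T i = relaxedPositions (a i) := by simp only [hT, if_pos hc]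
          by_cases hx : x = 1 ∨ x = a i - 1
          · refine Or.inr (Or.inr ⟨hx, i₀, hc.1.symm, ?_⟩)
            rw [hTi₀]
            exact fullPositions_neighbor (ha i₀) hi₀
          · rw [hTi, ← or_assoc]
            exact Or.inl (relaxedPositions_covers hc.2 (by omega) (by omega))
        · have hTi : T i = fullPositions (a i) := by simp only [hT, if_neg hc]
          rw [hTi, ← or_assoc]
          exact Or.inl (fullPositions_covers (ha i) hx0 hxa)
      · refine le_trans ?_ (add_le_sum_of_nonneg (fun i => surplus (a i) (T i)) hj fun k hk => ?_)
        · simpa [hTi₀, hT, hj] using hsum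
        · by_cases hc : a k = 4 ∨ a k = 8 ∨ a k = 14
          · have := surplus_relaxedPositions hc
            simp only [hT, hk, hc, ne_eq, not_false_eq_true, and_self, if_true]
            omega
          · have := (surplus_fullPositions (ha k)).2.1 (by omega)
            simp only [hT, hc, and_false, if_false]
            omega
    by_cases hN : ∃ i₀, ¬ (a i₀ = 4 ∨ a i₀ = 8 ∨ a i₀ = 14) ∧ a i₀ % 6 ≠ 3
    · obtain ⟨i₀, hi₀, h3⟩ := hN
      refine key i₀ h3 ⟨b, fun h => hi₀ (h ▸ hb), ?_⟩
      rw [if_pos hb]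
      have := surplus_relaxedPositions hb
      have := (surplus_fullPositions (ha i₀)).2.1 (by omega)
      omega
    · push Not at hN
      obtain ⟨j, hj⟩ := hother hm1 b
      refine key b (by omega) ⟨j, hj, ?_⟩
      have := (surplus_fullPositions (ha b)).1
      split_ifs with hc
      · have := surplus_relaxedPositions hc
        omega
      · have := (surplus_fullPositions (ha j)).2.2.2 (hN j (by omega))
        omega
  · push Not at hB
    have h2 : ∀ i, 2 ≤ surplus (a i) (fullPositions (a i)) := fun i =>
      (surplus_fullPositions (ha i)).2.1 (hB i)
    refine ⟨fun i => fullPositions (a i), hfull, fun i x hx0 hxa => ?_, ?_⟩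
    · rw [← or_assoc]
      exact Or.inl (fullPositions_covers (ha i) hx0 hxa)
    · let i : Fin m := ⟨0, hm⟩
      by_cases hm1 : m = 1
      · refine le_trans ((surplus_fullPositions (ha i)).2.2.1 (hone hm1 i)) ?_
        exact single_le_sum (f := fun i => surplus (a i) (fullPositions (a i)))
          (fun k _ => by have := h2 k; omega) (mem_univ i)
      · obtain ⟨j, hj⟩ := hother hm1 i
        refine le_trans ?_ (add_le_sum_of_nonneg
          (fun i => surplus (a i) (fullPositions (a i))) hj fun k _ => by have := h2 k; omega)
        have hi2 := h2 i
        have hj2 := h2 j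
        omega

end CycleBouquet

namespace SimpleGraph

variable {V : Type*} {G : SimpleGraph V}

lemma CliqueFree.dist_eq_two (htf : G.CliqueFree 3) {u v w : V} (hne : u ≠ w)
    (huv : G.Adj u v) (hvw : G.Adj v w) : G.dist u w = 2 := by
  have h : G.edist u w = 2 := by
    refine edist_eq_two_iff.2 ⟨hne, fun huw => ?_, v, huv, hvw.symm⟩
    classical exact htf {u, v, w} (is3Clique_triple_iff.2 ⟨huv, huw, hvw⟩)
  simp [SimpleGraph.dist, h]

namespace Walk

variable {v : V} {p : G.Walk v v}

lemma IsCycle.getVert_ne (hp : p.IsCycle) {x y : ℕ} (hxy : x < y) (hy : y ≤ p.length)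
    (h : ¬ (x = 0 ∧ y = p.length)) : p.getVert x ≠ p.getVert y := by
  intro heq
  rcases Nat.eq_zero_or_pos x with hx | hx
  · have := hp.getVert_injOn' (x₁ := x) (x₂ := y) (show x ≤ p.length - 1 by omega)
      (show y ≤ p.length - 1 by omega) heq
    omega
  · have := hp.getVert_injOn (x₁ := x) (x₂ := y) ⟨hx, by omega⟩ ⟨by omega, hy⟩ heq
    omega

lemma IsCycle.getVert_ne_base (hp : p.IsCycle) {x : ℕ} (hx0 : 0 < x) (hx : x < p.length) :
    p.getVert x ≠ v := by
  have := hp.getVert_ne hx0 hx.le (by omega)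
  rwa [getVert_zero, ne_comm] at this

lemma adj_base_getVert (hp : 0 < p.length) {x : ℕ} (hx : x = 1 ∨ x = p.length - 1) :
    G.Adj v (p.getVert x) := by
  rcases hx with rfl | rfl
  · simpa using p.adj_getVert_succ (i := 0) hp
  · have := p.adj_getVert_succ (i := p.length - 1) (by omega)
    rw [Nat.sub_add_cancel hp, getVert_length] at this
    exact this.symm

lemma IsCycle.dist_getVert_add_two (htf : G.CliqueFree 3) (hp : p.IsCycle) (hl : 4 ≤ p.length)
    {x : ℕ} (hx : x + 2 ≤ p.length) : G.dist (p.getVert x) (p.getVert (x + 2)) = 2 :=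
  htf.dist_eq_two (hp.getVert_ne (by omega) hx (by omega))
    (p.adj_getVert_succ (by omega)) (p.adj_getVert_succ (by omega))

lemma IsCycle.exists_dist_eq_two (htf : G.CliqueFree 3) (hp : p.IsCycle) (hl : 4 ≤ p.length)
    {T : Finset ℕ} (hT : ∀ y ∈ T, y < p.length) {S : Finset V} (hv : v ∈ S)
    (hS : ∀ y ∈ T, p.getVert y ∈ S) {x : ℕ} (hx : x < p.length)
    (hc : CycleBouquet.HopCovered p.length T x) : ∃ u ∈ S, G.dist u (p.getVert x) = 2 := by
  have hends : G.dist (p.getVert 1) (p.getVert (p.length - 1)) = 2 :=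
    htf.dist_eq_two (hp.getVert_ne (by omega) (by omega) (by omega))
      (adj_base_getVert (by omega) (Or.inl rfl)).symm (adj_base_getVert (by omega) (Or.inr rfl))
  rcases hc with rfl | h | h | ⟨y, hy, rfl⟩ | ⟨rfl, h⟩ | ⟨h, h1⟩
  · exact ⟨v, hv, by simpa using hp.dist_getVert_add_two htf hl (x := 0) (by omega)⟩
  · refine ⟨v, hv, ?_⟩
    have := hp.dist_getVert_add_two htf hl (x := x) (by omega)
    rwa [h, getVert_length, dist_comm] at this
  · refine ⟨_, hS _ h, ?_⟩
    rw [dist_comm]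
    exact hp.dist_getVert_add_two htf hl (hT _ h).le
  · exact ⟨_, hS _ hy, hp.dist_getVert_add_two htf hl hx.le⟩
  · exact ⟨_, hS _ h, by rwa [dist_comm]⟩
  · refine ⟨_, hS _ h1, ?_⟩
    rwa [show x = p.length - 1 by omega]

/-- A graph which consists of a single cycle is isomorphic to the cycle graph. -/
lemma IsCycle.nonempty_iso_cycleGraph (hp : p.IsCycle) (hsupp : ∀ x, x ∈ p.support)
    (hedge : ∀ e ∈ G.edgeSet, e ∈ p.edges) : Nonempty (G ≃g cycleGraph p.length) := by
  have hl := hp.three_le_length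
  let f : Fin p.length → V := fun x => p.getVert x
  have hinj : Function.Injective f := fun x y hxy =>
    Fin.ext (hp.getVert_injOn' (show x.1 ≤ p.length - 1 by omega)
      (show y.1 ≤ p.length - 1 by omega) hxy)
  have hsurj : Function.Surjective f := fun u => by
    obtain ⟨k, hk, hkl⟩ := mem_support_iff_exists_getVert.1 (hsupp u)
    rcases hkl.lt_or_eq with h | h
    · exact ⟨⟨k, h⟩, hk⟩
    · exact ⟨⟨0, by omega⟩, by simp only [f, getVert_zero, ← hk, h, getVert_length]⟩
  have hnext : ∀ i : Fin p.length, ∃ j : Fin p.length,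
      f j = p.getVert (i + 1) ∧ (j - i).val = 1 := fun i => by
    rcases (show i.1 + 1 ≤ p.length by omega).lt_or_eq with h | h
    · refine ⟨⟨i + 1, h⟩, rfl, ?_⟩
      rw [Fin.sub_val_of_le (by simp [Fin.le_def])]
      simp
    · refine ⟨⟨0, by omega⟩, ?_, ?_⟩
      · simp only [f, h, getVert_zero, getVert_length]
      · rw [Fin.coe_sub_iff_lt.2 (by simp only [Fin.lt_def]; omega)]
        dsimp only
        omega
  have hsub : ∀ i j k : Fin p.length, (j - i).val = 1 → (k - i).val = 1 → j = k := by
    intro i j k hj hk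
    have : NeZero p.length := ⟨by omega⟩
    exact sub_left_injective (Fin.ext (hj.trans hk.symm))
  refine ⟨(RelIso.mk (Equiv.ofBijective f ⟨hinj, hsurj⟩) ?_ : cycleGraph p.length ≃g G).symm⟩
  intro x y
  simp only [cycleGraph_adj']
  constructor
  · intro h
    obtain ⟨i, hi, he⟩ := (mk_mem_edges_iff_exists p).1 (hedge _ (G.mem_edgeSet.2 h))
    obtain ⟨j, hj, hji⟩ := hnext ⟨i, hi⟩
    rw [← hj, show p.getVert i = f ⟨i, hi⟩ from rfl, Sym2.eq_iff] at he
    rcases he with ⟨h1, h2⟩ | ⟨h1, h2⟩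
    · rw [hinj h1, hinj h2] at hji
      exact Or.inr hji
    · rw [hinj h1, hinj h2] at hji
      exact Or.inl hji
  · have hadj : ∀ x y : Fin p.length, (y - x).val = 1 → G.Adj (f x) (f y) := fun x y h => by
      obtain ⟨j, hj, hjx⟩ := hnext x
      rw [hsub x y j h hjx, hj]
      exact p.adj_getVert_succ x.2
    rintro (h | h)
    · exact (hadj y x h).symm
    · exact hadj x y h

end Walk

end SimpleGraph

namespace CycleBouquet

variable {V : Type*} {G : SimpleGraph V} {v : V} {m : ℕ} {p : Fin m → G.Walk v v}

lemma getVert_eq_iff (hcyc : ∀ i, (p i).IsCycle)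
    (hdisj : ∀ i j, i ≠ j → ∀ x, x ∈ (p i).support → x ∈ (p j).support → x = v)
    {i j : Fin m} {x y : ℕ} (hx0 : 0 < x) (hx : x < (p i).length) (hy0 : 0 < y)
    (hy : y < (p j).length) (h : (p i).getVert x = (p j).getVert y) : i = j ∧ x = y := by
  have hij : i = j := by
    by_contra hne
    refine (hcyc i).getVert_ne_base hx0 hx (hdisj i j hne _ ((p i).getVert_mem_support x) ?_)
    rw [h]
    exact (p j).getVert_mem_support y
  subst hij
  exact ⟨rfl, (hcyc i).getVert_injOn ⟨hx0, hx.le⟩ ⟨hy0, hy.le⟩ h⟩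

/-- The cycles of a bouquet share only their base point, so it has at least this many vertices. -/
lemma card_le [Fintype V] (hcyc : ∀ i, (p i).IsCycle)
    (hdisj : ∀ i j, i ≠ j → ∀ x, x ∈ (p i).support → x ∈ (p j).support → x = v) :
    1 + ∑ i, ((p i).length - 1) ≤ Fintype.card V := by
  let f : Option (Σ i, Fin ((p i).length - 1)) → V := fun o =>
    o.elim v fun s => (p s.1).getVert (s.2 + 1)
  have hlt : ∀ i, ∀ x : Fin ((p i).length - 1), x.1 + 1 < (p i).length := fun i x => by omega
  have hf : Function.Injective f := by
    rintro (_ | ⟨i, x⟩) (_ | ⟨j, y⟩) h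
    · rfl
    · exact ((hcyc j).getVert_ne_base (Nat.succ_pos y.1) (hlt j y) h.symm).elim
    · exact ((hcyc i).getVert_ne_base (Nat.succ_pos x.1) (hlt i x) h).elim
    · obtain ⟨rfl, hxy⟩ := getVert_eq_iff hcyc hdisj (Nat.succ_pos x.1) (hlt _ x)
        (Nat.succ_pos y.1) (hlt _ y) h
      rw [Fin.ext (Nat.succ_injective hxy)]
  have := Fintype.card_le_of_injective f hf
  simpa [add_comm] using this

end CycleBouquet

theorem hop_domination_cycle_bouquet {V : Type*} [Fintype V] (G : SimpleGraph V)
    (htf : G.CliqueFree 3) (m : ℕ) (hm : 1 ≤ m) (a : Fin m → ℕ) (ha : ∀ i, 4 ≤ a i)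
    (v : V) (hbouquet : IsCycleBouquet G v a)
    (h4 : ¬ Nonempty (G ≃g SimpleGraph.cycleGraph 4))
    (h7 : ¬ Nonempty (G ≃g SimpleGraph.cycleGraph 7))
    (h8 : ¬ Nonempty (G ≃g SimpleGraph.cycleGraph 8))
    (h14 : ¬ Nonempty (G ≃g SimpleGraph.cycleGraph 14)) :
    (∃ S : Finset V, G.IsHopDominatingSet S ∧ v ∈ S ∧ 5 * S.card ≤ 2 * Fintype.card V) ∧
    5 * G.hopDominationNumber ≤ 2 * Fintype.card V := by
  classical
  have bound : ∀ S : Finset V, G.IsHopDominatingSet S → G.hopDominationNumber ≤ S.card :=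
    fun S hS => Nat.sInf_le ⟨S, hS, rfl⟩
  suffices h : ∃ S : Finset V, G.IsHopDominatingSet S ∧ v ∈ S ∧
      5 * S.card ≤ 2 * Fintype.card V by
    obtain ⟨S, hS, hv, hc⟩ := h
    exact ⟨⟨S, hS, hv, hc⟩, by have := bound S hS; omega⟩
  obtain ⟨p, hcyc, hlen, hdisj, hsupp, hedge⟩ := hbouquet
  obtain rfl : (fun i => (p i).length) = a := funext hlen
  have hone : m = 1 → ∀ i, (p i).length ≠ 4 ∧ (p i).length ≠ 7 ∧ (p i).length ≠ 8 ∧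
      (p i).length ≠ 14 := by
    rintro rfl i
    have hiso := (hcyc i).nonempty_iso_cycleGraph
      (fun x => by obtain ⟨j, hj⟩ := hsupp x; rwa [Subsingleton.elim i j])
      (fun e he => by obtain ⟨j, hj⟩ := hedge e he; rwa [Subsingleton.elim i j])
    refine ⟨?_, ?_, ?_, ?_⟩ <;> intro h <;> rw [h] at hiso
    exacts [h4 hiso, h7 hiso, h8 hiso, h14 hiso]
  obtain ⟨T, hT, hcov, hsum⟩ := CycleBouquet.exists_positions hm _ ha hone
  let S : Finset V := insert v (Finset.univ.biUnion fun i => (T i).image (p i).getVert)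
  have hvS : v ∈ S := Finset.mem_insert_self _ _
  have hTS : ∀ i, ∀ x ∈ T i, (p i).getVert x ∈ S := fun i x hx =>
    Finset.mem_insert_of_mem
      (Finset.mem_biUnion.2 ⟨i, Finset.mem_univ i, Finset.mem_image_of_mem _ hx⟩)
  refine ⟨S, fun u hu => ?_, hvS, ?_⟩
  · obtain ⟨i, hi⟩ := hsupp u
    obtain ⟨x, rfl, hx⟩ := SimpleGraph.Walk.mem_support_iff_exists_getVert.1 hi
    have hx0 : 0 < x := by
      refine Nat.pos_of_ne_zero fun h => hu ?_
      rwa [h, SimpleGraph.Walk.getVert_zero]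
    have hxl : x < (p i).length := by
      refine hx.lt_of_ne fun h => hu ?_
      rwa [h, SimpleGraph.Walk.getVert_length]
    rcases hcov i x hx0 hxl with h | h | ⟨hx1, j, hji, hj⟩
    · exact (hu (hTS i x h)).elim
    · exact (hcyc i).exists_dist_eq_two htf (ha i) (fun y hy => (hT i y hy).2) hvS (hTS i) hxl h
    · obtain ⟨y, hy, hyT⟩ : ∃ y, (y = 1 ∨ y = (p j).length - 1) ∧ y ∈ T j := by
        rcases hj with h | h
        exacts [⟨_, Or.inl rfl, h⟩, ⟨_, Or.inr rfl, h⟩]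
      obtain ⟨hy0, hyl⟩ := hT j y hyT
      refine ⟨_, hTS j y hyT, htf.dist_eq_two (fun h => hji ?_)
        (SimpleGraph.Walk.adj_base_getVert (by omega) hy).symm
        (SimpleGraph.Walk.adj_base_getVert (by omega) hx1)⟩
      exact (CycleBouquet.getVert_eq_iff hcyc hdisj hy0 hyl hx0 hxl h).1
  · have hS : S.card ≤ 1 + ∑ i, (T i).card := by
      refine (Finset.card_insert_le _ _).trans ?_
      rw [add_comm]
      gcongr
      exact Finset.card_biUnion_le.trans (Finset.sum_le_sum fun i _ => Finset.card_image_le)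
    have hV := CycleBouquet.card_le hcyc hdisj
    have hlen1 : ∑ i, (((p i).length : ℤ) - 1) = ((∑ i, ((p i).length - 1) : ℕ) : ℤ) := by
      push_cast
      refine Finset.sum_congr rfl fun i _ => ?_
      have := ha i
      dsimp only at this
      omega
    simp only [CycleBouquet.surplus, Finset.sum_sub_distrib, ← Finset.mul_sum] at hsum
    rw [← Finset.sum_sub_distrib, hlen1, ← Nat.cast_sum] at hsum
    omega
end

section
/- Every connected finite simple graph G has a hop dominating set S with |S| = γ_h(G) such that for every pendent 4-cycle v₁v₂v₃v₄v₁ of G (an induced 4-cycle with deg_G(v₁) ≥ 3 and deg_G(v₂) = deg_G(v₃) = deg_G(v₄) = 2), the vertex v₁ belongs to S and S contains at least one neighbor of v₁. -/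
namespace SimpleGraph

variable {V : Type*} {G : SimpleGraph V}

theorem dist_eq_two_iff {u v : V} :
    G.dist u v = 2 ↔ u ≠ v ∧ ¬ G.Adj u v ∧ ∃ w, G.Adj u w ∧ G.Adj w v := by
  have h : G.dist u v = 2 ↔ G.edist u v = 2 := ENat.toNat_eq_iff two_ne_zero
  rw [h, edist_eq_two_iff]
  simp only [Set.Nonempty, mem_commonNeighbors, G.adj_comm v]

theorem eq_or_eq_of_adj_of_degree_eq_two {v a b w : V} [Fintype (G.neighborSet v)]
    (hdeg : G.degree v = 2) (ha : G.Adj v a) (hb : G.Adj v b) (hab : a ≠ b) (hw : G.Adj v w) :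
    w = a ∨ w = b := by
  classical
  have h : ({a, b} : Finset V) = G.neighborFinset v := by
    apply Finset.eq_of_subset_of_card_le
    · simp [Finset.insert_subset_iff, ha, hb]
    · rw [Finset.card_pair hab, card_neighborFinset_eq_degree, hdeg]
  simpa [← h] using (G.mem_neighborFinset v w).2 hw

/-- The vertices at distance two from the vertex opposite to the attachment vertex of a pendent
4-cycle consist of the attachment vertex alone. -/
theorem dist_eq_two_iff_eq_of_four_cycle {v₁ v₂ v₃ v₄ : V}
    [Fintype (G.neighborSet v₂)] [Fintype (G.neighborSet v₃)] [Fintype (G.neighborSet v₄)]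
    (h₁₃ : v₁ ≠ v₃) (h₂₄ : v₂ ≠ v₄)
    (a₁₂ : G.Adj v₁ v₂) (a₂₃ : G.Adj v₂ v₃) (a₃₄ : G.Adj v₃ v₄) (a₄₁ : G.Adj v₄ v₁)
    (n₁₃ : ¬ G.Adj v₁ v₃)
    (d₂ : G.degree v₂ = 2) (d₃ : G.degree v₃ = 2) (d₄ : G.degree v₄ = 2) (u : V) :
    G.dist v₃ u = 2 ↔ u = v₁ := by
  rw [dist_eq_two_iff]
  constructor
  · rintro ⟨hne, -, w, hw, hwu⟩
    rcases eq_or_eq_of_adj_of_degree_eq_two d₃ a₂₃.symm a₃₄ h₂₄ hw with rfl | rfl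
    · exact (eq_or_eq_of_adj_of_degree_eq_two d₂ a₁₂.symm a₂₃ h₁₃ hwu).resolve_right hne.symm
    · exact (eq_or_eq_of_adj_of_degree_eq_two d₄ a₄₁ a₃₄.symm h₁₃ hwu).resolve_right hne.symm
  · rintro rfl
    exact ⟨h₁₃.symm, fun h => n₁₃ h.symm, v₂, a₂₃.symm, a₁₂.symm⟩

/-- If `b` is hop dominated only through `a`, then `b` can be exchanged for `a`. -/
theorem IsHopDominatingSet.exchange [DecidableEq V] {S : Finset V} (hS : G.IsHopDominatingSet S)
    {a b : V} (h : ∀ u, G.dist b u = 2 ↔ u = a) : G.IsHopDominatingSet (insert a (S.erase b)) := by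
  intro v hv
  rw [Finset.mem_insert, Finset.mem_erase, not_or, not_and] at hv
  by_cases hvb : v = b
  · subst hvb
    exact ⟨a, Finset.mem_insert_self _ _, by rw [dist_comm, h]⟩
  · obtain ⟨u, hu, hd⟩ := hS v (hv.2 hvb)
    refine ⟨u, Finset.mem_insert_of_mem (Finset.mem_erase.2 ⟨?_, hu⟩), hd⟩
    rintro rfl
    exact hv.1 ((h v).1 hd)

/-- A hop dominating set contains a neighbor of the attachment vertex of a pendent 4-cycle. -/
theorem IsHopDominatingSet.exists_adj_of_four_cycle {S : Finset V} (hS : G.IsHopDominatingSet S)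
    {v₁ v₂ v₃ v₄ : V} [Fintype (G.neighborSet v₂)] [Fintype (G.neighborSet v₃)]
    (h₁₃ : v₁ ≠ v₃) (h₂₄ : v₂ ≠ v₄)
    (a₁₂ : G.Adj v₁ v₂) (a₂₃ : G.Adj v₂ v₃) (a₃₄ : G.Adj v₃ v₄) (a₄₁ : G.Adj v₄ v₁)
    (d₂ : G.degree v₂ = 2) (d₃ : G.degree v₃ = 2) : ∃ u ∈ S, G.Adj v₁ u := by
  by_cases h₂ : v₂ ∈ S
  · exact ⟨v₂, h₂, a₁₂⟩
  · obtain ⟨u, hu, hd⟩ := hS v₂ h₂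
    obtain ⟨hne, -, w, huw, hw⟩ := dist_eq_two_iff.1 hd
    refine ⟨u, hu, ?_⟩
    rcases eq_or_eq_of_adj_of_degree_eq_two d₂ a₁₂.symm a₂₃ h₁₃ hw.symm with rfl | rfl
    · exact huw.symm
    · obtain rfl := (eq_or_eq_of_adj_of_degree_eq_two d₃ a₂₃.symm a₃₄ h₂₄ huw.symm).resolve_left hne
      exact a₄₁.symm

theorem exists_isHopDominatingSet_card_eq [Fintype V] (G : SimpleGraph V) :
    ∃ S : Finset V, G.IsHopDominatingSet S ∧ S.card = G.hopDominationNumber :=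
  Nat.sInf_mem (s := {k : ℕ | ∃ S : Finset V, G.IsHopDominatingSet S ∧ S.card = k})
    ⟨_, Finset.univ, fun v hv => absurd (Finset.mem_univ v) hv, rfl⟩

end SimpleGraph

open SimpleGraph in
theorem hop_domination_pendent_four_cycle {V : Type*} [Fintype V] [DecidableEq V]
    (G : SimpleGraph V) [DecidableRel G.Adj] (hconn : G.Connected) :
    ∃ S : Finset V, G.IsHopDominatingSet S ∧ S.card = G.hopDominationNumber ∧
      ∀ v₁ v₂ v₃ v₄ : V, ([v₁, v₂, v₃, v₄] : List V).Nodup →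
        G.Adj v₁ v₂ → G.Adj v₂ v₃ → G.Adj v₃ v₄ → G.Adj v₄ v₁ →
        ¬ G.Adj v₁ v₃ → ¬ G.Adj v₂ v₄ →
        3 ≤ G.degree v₁ → G.degree v₂ = 2 → G.degree v₃ = 2 → G.degree v₄ = 2 →
        v₁ ∈ S ∧ ∃ u ∈ S, G.Adj v₁ u := by
  -- Among the minimum hop dominating sets, take one with the largest degree sum.
  obtain ⟨S, ⟨hS, hcard⟩, hmax⟩ := Set.Finite.exists_maximalFor
    (fun S : Finset V => ∑ v ∈ S, G.degree v)
    {S | G.IsHopDominatingSet S ∧ S.card = G.hopDominationNumber} (Set.toFinite _)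
    G.exists_isHopDominatingSet_card_eq
  refine ⟨S, hS, hcard, ?_⟩
  intro v₁ v₂ v₃ v₄ hnd a₁₂ a₂₃ a₃₄ a₄₁ n₁₃ _ d₁ d₂ d₃ d₄
  have h₁₃ : v₁ ≠ v₃ := by rintro rfl; simp at hnd
  have h₂₄ : v₂ ≠ v₄ := by rintro rfl; simp at hnd
  have hdist := dist_eq_two_iff_eq_of_four_cycle h₁₃ h₂₄ a₁₂ a₂₃ a₃₄ a₄₁ n₁₃ d₂ d₃ d₄
  refine ⟨?_, hS.exists_adj_of_four_cycle h₁₃ h₂₄ a₁₂ a₂₃ a₃₄ a₄₁ d₂ d₃⟩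
  by_contra h₁
  have h₃ : v₃ ∈ S := by
    by_contra h₃
    obtain ⟨u, hu, hd⟩ := hS v₃ h₃
    rw [dist_comm, hdist] at hd
    exact h₁ (hd ▸ hu)
  have h₁' : v₁ ∉ S.erase v₃ := fun h => h₁ (Finset.mem_of_mem_erase h)
  have hle := hmax (j := insert v₁ (S.erase v₃)) ⟨hS.exchange hdist, by
    rw [Finset.card_insert_of_notMem h₁', Finset.card_erase_add_one h₃, hcard]⟩
  have hsum := Finset.add_sum_erase S (fun v => G.degree v) h₃
  simp only [Finset.sum_insert h₁'] at hle hsum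
  omega
end

section
/- Let G be a connected finite simple graph on n vertices with minimum degree δ(G) ≥ 2. Then the domination number of G satisfies γ(G) ≤ (2n + 2)/5 (i.e., 5·γ(G) ≤ 2n + 2). -/
/-- A set `S` of vertices is a dominating set of `G` if every vertex not in `S`
has a neighbor in `S`. -/
def SimpleGraph.IsDominatingSet {V : Type*} (G : SimpleGraph V) (S : Finset V) : Prop :=
  ∀ v : V, v ∉ S → ∃ u ∈ S, G.Adj u v

/-- The domination number of `G`: the minimum cardinality of a dominating set. -/
noncomputable def SimpleGraph.dominationNumber {V : Type*} [Fintype V]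
    (G : SimpleGraph V) : ℕ :=
  sInf {k : ℕ | ∃ S : Finset V, G.IsDominatingSet S ∧ S.card = k}

namespace SimpleGraph

section RelativeDomination

open Classical

variable {V : Type*}

/-- The neighbours of `v` inside `T`. -/
noncomputable def nbrsIn (G : SimpleGraph V) (T : Finset V) (v : V) : Finset V :=
  T.filter (G.Adj v)

/-- The subgraph induced on `T` is connected (or empty), phrased by cuts: every partition of `T`
into two nonempty parts is crossed by an edge. -/
def Linked (G : SimpleGraph V) (T : Finset V) : Prop :=
  ∀ P ⊆ T, P.Nonempty → (T \ P).Nonempty → ∃ x ∈ P, ∃ y ∈ T \ P, G.Adj x y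

/-- Every vertex of `T` lies in `S` or has a neighbour in `S`. -/
def Dominates (G : SimpleGraph V) (S T : Finset V) : Prop :=
  ∀ v ∈ T, v ∈ S ∨ ∃ u ∈ S, G.Adj u v

/-- A vertex of `T` weighs `2`, plus the amount by which its degree inside `T` falls short
of `2`. -/
noncomputable def weight (G : SimpleGraph V) (T : Finset V) (v : V) : ℕ :=
  2 + (2 - (G.nbrsIn T v).card)

/-- The domination bound for the subgraph induced on `T`, with an extra unit allowed for each
missing degree. -/
def WeightBound (G : SimpleGraph V) (T : Finset V) : Prop :=
  ∃ S, G.Dominates S T ∧ 5 * S.card ≤ ∑ v ∈ T, G.weight T v + 2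

/-- `P` is separated from the rest of `T` by the single edge `uv`, with `v ∈ P`, both ends of
which have degree at least three inside `T`. -/
structure IsBridgeCut (G : SimpleGraph V) (T P : Finset V) (u v : V) : Prop where
  subset : P ⊆ T
  mem_outer : u ∈ T \ P
  mem_inner : v ∈ P
  three_le_outer : 3 ≤ (G.nbrsIn T u).card
  three_le_inner : 3 ≤ (G.nbrsIn T v).card
  adj : G.Adj u v
  eq_of_adj : ∀ x ∈ P, ∀ y ∈ T \ P, G.Adj x y → x = v ∧ y = u

variable {G : SimpleGraph V} {S T R D P : Finset V}

lemma mem_nbrsIn {v w : V} : w ∈ G.nbrsIn T v ↔ w ∈ T ∧ G.Adj v w := by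
  simp [nbrsIn]

lemma two_mul_card_le_sum_weight (R : Finset V) : 2 * R.card ≤ ∑ v ∈ R, G.weight T v := by
  have := Finset.card_nsmul_le_sum R (G.weight T) 2 (fun _ _ => by simp [weight])
  simpa [mul_comm] using this

lemma sum_le_sum_add_of_forall_ne {f g : V → ℕ} (z : V) (δ : ℕ)
    (h : ∀ x ∈ T, x ≠ z → f x ≤ g x) (hz : z ∈ T → f z ≤ g z + δ) :
    ∑ x ∈ T, f x ≤ ∑ x ∈ T, g x + δ := by
  calc ∑ x ∈ T, f x ≤ ∑ x ∈ T, (g x + if x = z then δ else 0) := by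
        refine Finset.sum_le_sum fun x hx => ?_
        split_ifs with hxz
        · subst hxz; exact hz hx
        · simpa using h x hx hxz
    _ ≤ ∑ x ∈ T, g x + δ := by
        rw [Finset.sum_add_distrib, Finset.sum_ite_eq']
        split_ifs <;> simp

lemma weight_le_weight {G' : SimpleGraph V} {T' : Finset V} {v : V}
    (h : (G.nbrsIn T v).card ≤ (G'.nbrsIn T' v).card) : G'.weight T' v ≤ G.weight T v := by
  unfold weight; omega

lemma Linked.eq_of_closed (hT : G.Linked T) (hR : R ⊆ T) (hne : R.Nonempty)
    (h : ∀ x ∈ R, ∀ y ∈ T, G.Adj x y → y ∈ R) : T = R := by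
  by_contra hTR
  have : (T \ R).Nonempty := by
    rw [Finset.sdiff_nonempty]
    exact fun h' => hTR (h'.antisymm hR)
  obtain ⟨x, hx, y, hy, hxy⟩ := hT R hR hne this
  grind

lemma Linked.weightBound_of_closed (hT : G.Linked T) (hR : R ⊆ T) (hne : R.Nonempty)
    (h : ∀ x ∈ R, ∀ y ∈ T, G.Adj x y → y ∈ R) (hD : G.Dominates D R)
    (hcard : 5 * D.card ≤ ∑ v ∈ R, G.weight T v + 2) : G.WeightBound T := by
  obtain rfl := hT.eq_of_closed hR hne h
  exact ⟨D, hD, hcard⟩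

lemma Linked.sdiff (hT : G.Linked T) (z : V)
    (hz : ∀ x ∈ T \ R, ∀ r ∈ R, G.Adj x r → x = z) : G.Linked (T \ R) := by
  have key : ∀ P ⊆ T \ R, P.Nonempty → ((T \ R) \ P).Nonempty → z ∉ P →
      ∃ x ∈ P, ∃ y ∈ (T \ R) \ P, G.Adj x y := by
    intro P hP hne hne' hzP
    obtain ⟨x, hx, y, hy, hxy⟩ := hT P (hP.trans Finset.sdiff_subset) hne
      (hne'.mono (by grind))
    refine ⟨x, hx, y, ?_, hxy⟩
    grind
  intro P hP hne hne'
  by_cases hzP : z ∈ P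
  · obtain ⟨x, hx, y, hy, hxy⟩ := key ((T \ R) \ P) Finset.sdiff_subset hne'
      (by grind) (by grind)
    exact ⟨y, by grind, x, hx, hxy.symm⟩
  · exact key P hP hne hne' hzP

/-- Removing a part `R` attached to the rest of `T` at a single vertex `z`. -/
lemma Linked.weightBound_of_sdiff (hT : G.Linked T)
    (ih : ∀ T' : Finset V, T'.card < T.card → G.Linked T' → G.WeightBound T')
    (hR : R ⊆ T) (hne : R.Nonempty) (z : V) (δ : ℕ)
    (hz : ∀ x ∈ T \ R, ∀ r ∈ R, G.Adj x r → x = z)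
    (hδ : z ∈ T \ R → G.weight (T \ R) z ≤ G.weight T z + δ)
    (hD : G.Dominates D R) (hcard : 5 * D.card + δ ≤ ∑ v ∈ R, G.weight T v) :
    G.WeightBound T := by
  obtain ⟨S, hS, hScard⟩ := ih (T \ R)
    (Finset.card_lt_card (Finset.sdiff_ssubset hR hne)) (hT.sdiff z hz)
  refine ⟨S ∪ D, ?_, ?_⟩
  · intro v hv
    by_cases hvR : v ∈ R
    · have := hD v hvR
      grind
    · have := hS v (by grind)
      grind
  · have h1 : ∑ x ∈ T \ R, G.weight (T \ R) x ≤ ∑ x ∈ T \ R, G.weight T x + δ := by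
      refine sum_le_sum_add_of_forall_ne z δ (fun x hx hxz => ?_) hδ
      refine weight_le_weight (Finset.card_le_card fun y hy => ?_)
      rw [mem_nbrsIn] at hy ⊢
      grind
    have h2 := Finset.sum_sdiff (f := G.weight T) hR
    have h3 := Finset.card_union_le S D
    omega

/-- Contracting the path `u a b c v`, whose inner vertices have degree two, to the edge `uv`. -/
lemma Linked.weightBound_of_contract (hT : G.Linked T)
    (ih : ∀ (G' : SimpleGraph V) (T' : Finset V), T'.card < T.card → G'.Linked T' →
      G'.WeightBound T') {a b c u v : V} (ha : a ∈ T)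
    (hbc : b ≠ c) (hub : u ≠ b) (hvb : v ≠ b) (hac : a ≠ c)
    (hNa : G.nbrsIn T a = {b, u}) (hNb : G.nbrsIn T b = {a, c}) (hNc : G.nbrsIn T c = {b, v})
    (huc : u ≠ c)
    (hw : ∑ x ∈ T \ {a, b, c}, (G ⊔ edge u v).weight (T \ {a, b, c}) x ≤
      ∑ x ∈ T \ {a, b, c}, G.weight T x + 1) :
    G.WeightBound T := by
  have hA : ∀ y ∈ T, G.Adj a y → y = b ∨ y = u := fun y hy hay => by
    have : y ∈ G.nbrsIn T a := mem_nbrsIn.2 ⟨hy, hay⟩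
    simpa [hNa] using this
  have hB : ∀ y ∈ T, G.Adj b y → y = a ∨ y = c := fun y hy hay => by
    have : y ∈ G.nbrsIn T b := mem_nbrsIn.2 ⟨hy, hay⟩
    simpa [hNb] using this
  have hC : ∀ y ∈ T, G.Adj c y → y = b ∨ y = v := fun y hy hay => by
    have : y ∈ G.nbrsIn T c := mem_nbrsIn.2 ⟨hy, hay⟩
    simpa [hNc] using this
  have hab : b ∈ T ∧ G.Adj a b := mem_nbrsIn.1 (by simp [hNa])
  have hau : u ∈ T ∧ G.Adj a u := mem_nbrsIn.1 (by simp [hNa])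
  have hbc' : c ∈ T ∧ G.Adj b c := mem_nbrsIn.1 (by simp [hNb])
  have hcv : v ∈ T ∧ G.Adj c v := mem_nbrsIn.1 (by simp [hNc])
  set R : Finset V := {a, b, c} with hRdef
  have hR : R ⊆ T := by grind
  have hlinked : (G ⊔ edge u v).Linked (T \ R) := by
    have key : ∀ P ⊆ T \ R, P.Nonempty → ((T \ R) \ P).Nonempty → u ∉ P → v ∉ P →
        ∃ x ∈ P, ∃ y ∈ (T \ R) \ P, G.Adj x y := by
      intro P hP hne hne' huP hvP
      obtain ⟨x, hx, y, hy, hxy⟩ := hT P (hP.trans Finset.sdiff_subset) hne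
        (hne'.mono (by grind))
      refine ⟨x, hx, y, ?_, hxy⟩
      have := hxy.symm
      grind
    intro P hP hne hne'
    by_cases huP : u ∈ P <;> by_cases hvP : v ∈ P
    · obtain ⟨x, hx, y, hy, hxy⟩ := key ((T \ R) \ P) Finset.sdiff_subset hne'
        (by grind) (by grind) (by grind)
      exact ⟨y, by grind, x, hx, Or.inl hxy.symm⟩
    · refine ⟨u, huP, v, ?_, Or.inr ?_⟩
      · have := hcv.2.ne
        have : v ≠ a := by
          rintro rfl
          have := hA c hbc'.1 hcv.2.symm
          grind
        grind
      · rw [edge_adj]; grind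
    · refine ⟨v, hvP, u, ?_, Or.inr ?_⟩
      · have := hau.2.ne
        grind
      · rw [edge_adj]; grind
    · obtain ⟨x, hx, y, hy, hxy⟩ := key P hP hne hne' huP hvP
      exact ⟨x, hx, y, hy, Or.inl hxy⟩
  obtain ⟨S, hS, hScard⟩ := ih _ _
    (Finset.card_lt_card (Finset.sdiff_ssubset hR ⟨a, by grind⟩)) hlinked
  have hsum := Finset.sum_sdiff (f := G.weight T) hR
  have hRcard : R.card = 3 := by
    rw [hRdef, Finset.card_eq_three]
    exact ⟨a, b, c, hab.2.ne, hac, hbc, rfl⟩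
  have hR6 := two_mul_card_le_sum_weight (G := G) (T := T) R
  have bound : ∀ t, G.Dominates (insert t S) T → G.WeightBound T := fun t ht =>
    ⟨_, ht, by have := Finset.card_insert_le t S; omega⟩
  have hS' : ∀ x ∈ T, x ∉ R → x ∈ S ∨ (∃ y ∈ S, G.Adj y x) ∨ (x = v ∧ u ∈ S) ∨
      (x = u ∧ v ∈ S) := by
    intro x hx hxR
    rcases hS x (by grind) with h | ⟨y, hy, h | h⟩
    · exact Or.inl h
    · exact Or.inr (Or.inl ⟨y, hy, h⟩)
    · rw [edge_adj] at h
      grind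
  have hba := hab.2.symm
  have hcb := hbc'.2.symm
  have hua := hau.2.symm
  have hvc := hcv.2.symm
  by_cases huS : u ∈ S
  · refine bound c fun x hx => ?_
    have := hS' x hx
    grind
  by_cases hvS : v ∈ S
  · refine bound a fun x hx => ?_
    have := hS' x hx
    grind
  · refine bound b fun x hx => ?_
    have := hS' x hx
    grind

lemma exists_nbrsIn_eq_pair {a b : V} (h : (G.nbrsIn T a).card = 2) (hb : b ∈ G.nbrsIn T a) :
    ∃ u, u ≠ b ∧ G.nbrsIn T a = {b, u} := by
  obtain ⟨x, y, hxy, h⟩ := Finset.card_eq_two.1 h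
  rw [h] at hb
  rcases Finset.mem_insert.1 hb with rfl | hb
  · exact ⟨y, hxy.symm, h⟩
  · obtain rfl := Finset.mem_singleton.1 hb
    exact ⟨x, hxy, by rw [h, Finset.pair_comm]⟩

lemma card_nbrsIn_le_add_card {G' : SimpleGraph V} {T' : Finset V} {u : V} (E : Finset V)
    (h : ∀ y ∈ T, G.Adj u y → y ∈ E ∨ (y ∈ T' ∧ G'.Adj u y)) :
    (G.nbrsIn T u).card ≤ (G'.nbrsIn T' u).card + E.card := by
  refine (Finset.card_le_card (t := G'.nbrsIn T' u ∪ E) fun y hy => ?_).trans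
    (Finset.card_union_le _ _)
  rw [mem_nbrsIn] at hy
  rw [Finset.mem_union, mem_nbrsIn]
  exact (h y hy.1 hy.2).symm

lemma card_nbrsIn_le_of_exchange {G' : SimpleGraph V} {T' : Finset V} {u v a : V}
    (h : ∀ y ∈ T, G.Adj u y → y = a ∨ (y ∈ T' ∧ G'.Adj u y))
    (hv : v ∈ T') (huv : G'.Adj u v) (hnot : ¬ G.Adj u v) :
    (G.nbrsIn T u).card ≤ (G'.nbrsIn T' u).card := by
  have hmem : v ∈ G'.nbrsIn T' u := mem_nbrsIn.2 ⟨hv, huv⟩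
  have h1 : (G.nbrsIn T u).card ≤ (insert a ((G'.nbrsIn T' u).erase v)).card := by
    refine Finset.card_le_card fun y hy => ?_
    rw [mem_nbrsIn] at hy
    rw [Finset.mem_insert, Finset.mem_erase, mem_nbrsIn]
    grind
  have h2 := Finset.card_insert_le a ((G'.nbrsIn T' u).erase v)
  have h3 := Finset.card_erase_add_one hmem
  omega

/-- A vertex of degree two both of whose neighbours have degree two. -/
lemma Linked.weightBound_of_three_path (hT : G.Linked T)
    (ih : ∀ (G' : SimpleGraph V) (T' : Finset V), T'.card < T.card → G'.Linked T' →
      G'.WeightBound T') {a b c : V} (hb : b ∈ T) (hac : a ≠ c)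
    (hNb : G.nbrsIn T b = {a, c}) (ha2 : (G.nbrsIn T a).card = 2)
    (hc2 : (G.nbrsIn T c).card = 2) : G.WeightBound T := by
  have hba : a ∈ T ∧ G.Adj b a := mem_nbrsIn.1 (by simp [hNb])
  have hbc : c ∈ T ∧ G.Adj b c := mem_nbrsIn.1 (by simp [hNb])
  obtain ⟨u, hub, hNa⟩ := exists_nbrsIn_eq_pair ha2 (mem_nbrsIn.2 ⟨hb, hba.2.symm⟩)
  obtain ⟨v, hvb, hNc⟩ := exists_nbrsIn_eq_pair hc2 (mem_nbrsIn.2 ⟨hb, hbc.2.symm⟩)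
  have hA : ∀ y ∈ T, G.Adj a y → y = b ∨ y = u := fun y hy hay => by
    have : y ∈ G.nbrsIn T a := mem_nbrsIn.2 ⟨hy, hay⟩
    simpa [hNa] using this
  have hB : ∀ y ∈ T, G.Adj b y → y = a ∨ y = c := fun y hy hay => by
    have : y ∈ G.nbrsIn T b := mem_nbrsIn.2 ⟨hy, hay⟩
    simpa [hNb] using this
  have hC : ∀ y ∈ T, G.Adj c y → y = b ∨ y = v := fun y hy hay => by
    have : y ∈ G.nbrsIn T c := mem_nbrsIn.2 ⟨hy, hay⟩
    simpa [hNc] using this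
  have hau : u ∈ T ∧ G.Adj a u := mem_nbrsIn.1 (by simp [hNa])
  have hcv : v ∈ T ∧ G.Adj c v := mem_nbrsIn.1 (by simp [hNc])
  have hau' := hau.2.ne
  have hcv' := hcv.2.ne
  have hba' := hba.2.ne
  have hbc' := hbc.2.ne
  have hua := hau.2.symm
  have hvc := hcv.2.symm
  have hab := hba.2.symm
  have hcb := hbc.2.symm
  by_cases huc : u = c
  · have hva : v = a := by
      have := hC a hba.1 (huc ▸ hua)
      grind
    refine hT.weightBound_of_closed (R := {a, b, c}) (D := {b}) (by grind) (by simp)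
      (by grind) (by intro x hx; grind) ?_
    have := two_mul_card_le_sum_weight (G := G) (T := T) {a, b, c}
    rw [Finset.card_eq_three.2 ⟨a, b, c, hba'.symm, hac, hbc', rfl⟩] at this
    rw [Finset.card_singleton]
    omega
  have hva : v ≠ a := by
    rintro rfl
    have := hA c hbc.1 hvc
    grind
  have contract := hT.weightBound_of_contract ih hba.1 hbc' hub hvb hac hNa hNb hNc huc
  set R : Finset V := {a, b, c} with hR
  set G' := G ⊔ edge u v with hG'
  have hGG' : ∀ {x y}, G.Adj x y → G'.Adj x y := fun h => Or.inl h
  have huT' : u ∈ T \ R := by grind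
  have hvT' : v ∈ T \ R := by grind
  have hother : ∀ x ∈ T \ R, x ≠ u → x ≠ v → G'.weight (T \ R) x ≤ G.weight T x := by
    intro x hx hxu hxv
    refine weight_le_weight (Finset.card_le_card fun y hy => ?_)
    rw [mem_nbrsIn] at hy ⊢
    have := hy.2.symm
    exact ⟨by grind, hGG' hy.2⟩
  by_cases huv : u = v
  · subst huv
    by_cases hu2 : (G.nbrsIn T u).card ≤ 2
    · have hNu : G.nbrsIn T u = {a, c} := by
        symm
        refine Finset.eq_of_subset_of_card_le (fun y hy => ?_) (by rwa [Finset.card_pair hac])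
        rw [mem_nbrsIn]
        grind
      have hU : ∀ y ∈ T, G.Adj u y → y = a ∨ y = c := fun y hy hay => by
        have : y ∈ G.nbrsIn T u := mem_nbrsIn.2 ⟨hy, hay⟩
        simpa [hNu] using this
      refine hT.weightBound_of_closed (R := {u, a, b, c}) (D := {u, b}) (by grind) (by simp)
        (by grind) (by intro x hx; grind) ?_
      have := two_mul_card_le_sum_weight (G := G) (T := T) {u, a, b, c}
      rw [Finset.card_eq_of_equiv_fin (n := 4) ?_] at this
      · rw [Finset.card_pair hub]
        omega
      · exact Finset.equivFinOfCardEq (by grind)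
    · refine contract (sum_le_sum_add_of_forall_ne u 1 (fun x hx hxu => hother x hx hxu hxu) ?_)
      intro _
      have := card_nbrsIn_le_add_card (G := G) (T := T) (G' := G') (T' := T \ R) (u := u) {a, c}
        (by intro y hy huy; have := huy.symm; grind)
      rw [Finset.card_pair hac] at this
      unfold weight
      omega
  by_cases hadj : G.Adj u v
  · have hu := card_nbrsIn_le_add_card (G := G) (T := T) (G' := G') (T' := T \ R) (u := u) {a}
      (by intro y hy huy; have := huy.symm; grind)
    have hv := card_nbrsIn_le_add_card (G := G) (T := T) (G' := G') (T' := T \ R) (u := v) {c}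
      (by intro y hy huy; have := huy.symm; grind)
    rw [Finset.card_singleton] at hu hv
    by_cases hu3 : 3 ≤ (G.nbrsIn T u).card
    · refine contract (sum_le_sum_add_of_forall_ne v 1 (fun x hx hxv => ?_) fun _ => ?_)
      · by_cases hxu : x = u
        · subst hxu; unfold weight; omega
        · exact hother x hx hxu hxv
      · unfold weight; omega
    by_cases hv3 : 3 ≤ (G.nbrsIn T v).card
    · refine contract (sum_le_sum_add_of_forall_ne u 1 (fun x hx hxu => ?_) fun _ => ?_)
      · by_cases hxv : x = v
        · subst hxv; unfold weight; omega
        · exact hother x hx hxu hxv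
      · unfold weight; omega
    have hNu : G.nbrsIn T u = {a, v} := by
      symm
      refine Finset.eq_of_subset_of_card_le (fun y hy => ?_)
        (by rw [Finset.card_pair hva.symm]; omega)
      rw [mem_nbrsIn]
      grind
    have hNv : G.nbrsIn T v = {c, u} := by
      have := hadj.symm
      symm
      refine Finset.eq_of_subset_of_card_le (fun y hy => ?_)
        (by rw [Finset.card_pair (Ne.symm huc)]; omega)
      rw [mem_nbrsIn]
      grind
    have hU : ∀ y ∈ T, G.Adj u y → y = a ∨ y = v := fun y hy hay => by
      have : y ∈ G.nbrsIn T u := mem_nbrsIn.2 ⟨hy, hay⟩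
      simpa [hNu] using this
    have hV : ∀ y ∈ T, G.Adj v y → y = c ∨ y = u := fun y hy hay => by
      have : y ∈ G.nbrsIn T v := mem_nbrsIn.2 ⟨hy, hay⟩
      simpa [hNv] using this
    refine hT.weightBound_of_closed (R := {u, v, a, b, c}) (D := {u, b}) (by grind) (by simp)
      (by grind) (by intro x hx; grind) ?_
    have := two_mul_card_le_sum_weight (G := G) (T := T) {u, v, a, b, c}
    have h5 : ({u, v, a, b, c} : Finset V).card = 5 := by grind
    rw [Finset.card_pair hub]
    omega
  · refine contract ((Finset.sum_le_sum fun x hx => ?_).trans (Nat.le_succ _))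
    by_cases hxu : x = u
    · subst hxu
      refine weight_le_weight (card_nbrsIn_le_of_exchange (v := v) (a := a) ?_ hvT' ?_ hadj)
      · intro y hy huy; have := huy.symm; grind
      · exact Or.inr (by rw [edge_adj]; grind)
    by_cases hxv : x = v
    · subst hxv
      refine weight_le_weight (card_nbrsIn_le_of_exchange (v := u) (a := c) ?_ huT' ?_
        fun h => hadj h.symm)
      · intro y hy huy; have := huy.symm; grind
      · exact Or.inr (by rw [edge_adj]; grind)
    exact hother x hx hxu hxv

lemma Linked.weightBound_or_of_card_le_one (hT : G.Linked T)
    (ih : ∀ T' : Finset V, T'.card < T.card → G.Linked T' → G.WeightBound T')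
    {x : V} (hx : x ∈ T) (hx1 : (G.nbrsIn T x).card ≤ 1) :
    G.WeightBound T ∨ ∃ w ∈ T, G.Adj x w ∧ 3 ≤ (G.nbrsIn T w).card := by
  rw [or_iff_not_imp_right]
  intro hlarge
  push Not at hlarge
  have hadj : ∀ {p q}, q ∈ G.nbrsIn T p ↔ q ∈ T ∧ G.Adj p q := mem_nbrsIn
  rcases Nat.le_one_iff_eq_zero_or_eq_one.1 hx1 with hx0 | hx1
  · have hN := Finset.card_eq_zero.1 hx0
    refine hT.weightBound_of_closed (R := {x}) (D := {x}) (by simpa) (by simp) ?_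
      (by intro y hy; exact Or.inl hy) (by simp [weight, hx0])
    intro y hy z hz hyz
    have : z ∈ G.nbrsIn T y := hadj.2 ⟨hz, hyz⟩
    grind
  obtain ⟨w, hNx⟩ := Finset.card_eq_one.1 hx1
  have hxw : w ∈ T ∧ G.Adj x w := mem_nbrsIn.1 (by simp [hNx])
  have hwx := hxw.2.symm
  have hxw' := hxw.2.ne
  have hX : ∀ y ∈ T, G.Adj x y → y = w := fun y hy h => by
    have : y ∈ G.nbrsIn T x := hadj.2 ⟨hy, h⟩
    simpa [hNx] using this
  have hw2 := hlarge w hxw.1 hxw.2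
  have hwpos : 0 < (G.nbrsIn T w).card := Finset.card_pos.2 ⟨x, hadj.2 ⟨hx, hwx⟩⟩
  by_cases hw1 : (G.nbrsIn T w).card = 1
  · obtain ⟨x', hNw⟩ := Finset.card_eq_one.1 hw1
    have hW : ∀ y ∈ T, G.Adj w y → y = x := fun y hy h => by
      have h1 : y ∈ G.nbrsIn T w := hadj.2 ⟨hy, h⟩
      have h2 : x ∈ G.nbrsIn T w := hadj.2 ⟨hx, hwx⟩
      grind
    refine hT.weightBound_of_closed (R := {x, w}) (D := {w}) (by grind) (by simp) (by grind)
      (by intro y hy; grind) ?_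
    rw [Finset.sum_pair hxw', Finset.card_singleton]
    unfold weight
    omega
  obtain ⟨z, hzx, hNw⟩ := exists_nbrsIn_eq_pair (b := x) (by omega) (hadj.2 ⟨hx, hwx⟩)
  have hwz : z ∈ T ∧ G.Adj w z := mem_nbrsIn.1 (by simp [hNw])
  have hzw := hwz.2.symm
  have hwz' := hwz.2.ne
  have hW : ∀ y ∈ T, G.Adj w y → y = x ∨ y = z := fun y hy h => by
    have : y ∈ G.nbrsIn T w := hadj.2 ⟨hy, h⟩
    simpa [hNw] using this
  have hwx_weight : 5 ≤ G.weight T x + G.weight T w := by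
    unfold weight
    omega
  by_cases hz3 : 3 ≤ (G.nbrsIn T z).card
  · refine hT.weightBound_of_sdiff ih (R := {x, w}) (D := {w}) (by grind) (by simp) z 0 ?_ ?_
      (by intro y hy; grind) ?_
    · intro y hy r hr hyr
      have := hyr.symm
      grind
    · intro _
      have := card_nbrsIn_le_add_card (G := G) (T := T) (G' := G) (T' := T \ {x, w}) (u := z) {w}
        (by intro y hy huy; have := huy.symm; grind)
      rw [Finset.card_singleton] at this
      unfold weight
      omega
    · rw [Finset.sum_pair hxw', Finset.card_singleton]
      omega
  have hsum : 7 ≤ ∑ v ∈ {x, w, z}, G.weight T v := by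
    rw [Finset.sum_insert (by grind), Finset.sum_pair hwz']
    have : 2 ≤ G.weight T z := by unfold weight; omega
    omega
  have hzpos : 0 < (G.nbrsIn T z).card := Finset.card_pos.2 ⟨w, hadj.2 ⟨hxw.1, hzw⟩⟩
  by_cases hz1 : (G.nbrsIn T z).card = 1
  · obtain ⟨w', hNz⟩ := Finset.card_eq_one.1 hz1
    have hZ : ∀ y ∈ T, G.Adj z y → y = w := fun y hy h => by
      have h1 : y ∈ G.nbrsIn T z := hadj.2 ⟨hy, h⟩
      have h2 : w ∈ G.nbrsIn T z := hadj.2 ⟨hxw.1, hzw⟩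
      grind
    refine hT.weightBound_of_closed (R := {x, w, z}) (D := {w}) (by grind) (by simp) (by grind)
      (by intro y hy; grind) ?_
    rw [Finset.card_singleton]
    omega
  obtain ⟨y, hyw, hNz⟩ := exists_nbrsIn_eq_pair (b := w) (by omega) (hadj.2 ⟨hxw.1, hzw⟩)
  have hZ : ∀ t ∈ T, G.Adj z t → t = w ∨ t = y := fun t ht h => by
    have : t ∈ G.nbrsIn T z := hadj.2 ⟨ht, h⟩
    simpa [hNz] using this
  refine hT.weightBound_of_sdiff ih (R := {x, w, z}) (D := {w}) (by grind) (by simp) y 1 ?_ ?_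
    (by intro y hy; grind) ?_
  · intro t ht r hr htr
    have := htr.symm
    grind
  · intro _
    have := card_nbrsIn_le_add_card (G := G) (T := T) (G' := G) (T' := T \ {x, w, z}) (u := y) {z}
      (by intro t ht hyt; have := hyt.symm; grind)
    rw [Finset.card_singleton] at this
    unfold weight
    omega
  · rw [Finset.card_singleton]
    omega

lemma Linked.weightBound_or_exists_large (hT : G.Linked T)
    (ih : ∀ (G' : SimpleGraph V) (T' : Finset V), T'.card < T.card → G'.Linked T' →
      G'.WeightBound T') :
    G.WeightBound T ∨ ∀ b ∈ T, (G.nbrsIn T b).card ≤ 2 →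
      ∃ w ∈ T, G.Adj b w ∧ 3 ≤ (G.nbrsIn T w).card := by
  rw [or_iff_not_imp_left]
  intro hnot b hb hb2
  have leaf : ∀ x ∈ T, (G.nbrsIn T x).card ≤ 1 →
      ∃ w ∈ T, G.Adj x w ∧ 3 ≤ (G.nbrsIn T w).card := fun x hx hx1 =>
    (hT.weightBound_or_of_card_le_one (ih G) hx hx1).resolve_left hnot
  by_cases hb1 : (G.nbrsIn T b).card ≤ 1
  · exact leaf b hb hb1
  obtain ⟨a, c, hac, hNb⟩ := Finset.card_eq_two.1 (show (G.nbrsIn T b).card = 2 by omega)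
  have small : ∀ w ∈ G.nbrsIn T b, 3 ≤ (G.nbrsIn T w).card ∨ (G.nbrsIn T w).card = 2 := by
    intro w hw
    obtain ⟨hwT, hbw⟩ := mem_nbrsIn.1 hw
    by_contra! hcon
    obtain ⟨t, ht, hwt, ht3⟩ := leaf w hwT (by omega)
    have : 1 < (G.nbrsIn T w).card := Finset.one_lt_card.2
      ⟨b, mem_nbrsIn.2 ⟨hb, hbw.symm⟩, t, mem_nbrsIn.2 ⟨ht, hwt⟩, by rintro rfl; omega⟩
    omega
  have ha : a ∈ G.nbrsIn T b := by simp [hNb]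
  have hc : c ∈ G.nbrsIn T b := by simp [hNb]
  rcases small a ha with ha3 | ha2
  · exact ⟨a, (mem_nbrsIn.1 ha).1, (mem_nbrsIn.1 ha).2, ha3⟩
  rcases small c hc with hc3 | hc2
  · exact ⟨c, (mem_nbrsIn.1 hc).1, (mem_nbrsIn.1 hc).2, hc3⟩
  exact absurd (hT.weightBound_of_three_path ih hb hac hNb ha2 hc2) hnot

lemma IsBridgeCut.swap {u v : V} (h : G.IsBridgeCut T P u v) : G.IsBridgeCut T (T \ P) v u where
  subset := Finset.sdiff_subset
  mem_outer := by
    rw [Finset.sdiff_sdiff_eq_self h.subset]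
    exact h.mem_inner
  mem_inner := h.mem_outer
  three_le_outer := h.three_le_inner
  three_le_inner := h.three_le_outer
  adj := h.adj.symm
  eq_of_adj x hx y hy hxy := by
    rw [Finset.sdiff_sdiff_eq_self h.subset] at hy
    exact (h.eq_of_adj y hy x hx hxy.symm).symm

/-- An edge between two vertices of degree at least three can be deleted unless it is a bridge. -/
lemma Linked.weightBound_or_exists_isBridgeCut (hT : G.Linked T)
    (ih : ∀ G' : SimpleGraph V, ∑ x ∈ T, (G'.nbrsIn T x).card < ∑ x ∈ T, (G.nbrsIn T x).card →
      G'.Linked T → G'.WeightBound T) {u v : V} (hu : u ∈ T) (hv : v ∈ T) (huv : G.Adj u v)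
    (hu3 : 3 ≤ (G.nbrsIn T u).card) (hv3 : 3 ≤ (G.nbrsIn T v).card) :
    G.WeightBound T ∨ ∃ P, G.IsBridgeCut T P u v := by
  set G' := G \ edge u v with hG'
  have hadj : ∀ {x y}, G'.Adj x y ↔ G.Adj x y ∧ ¬ ((x = u ∧ y = v) ∨ (x = v ∧ y = u)) := by
    intro x y
    rw [hG', sdiff_adj, edge_adj]
    have : G.Adj x y → x ≠ y := fun h => h.ne
    grind
  by_cases hlink : G'.Linked T
  · left
    have hsub : ∀ x, G'.nbrsIn T x ⊆ G.nbrsIn T x := fun x y hy => by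
      rw [mem_nbrsIn] at hy ⊢
      exact ⟨hy.1, (hadj.1 hy.2).1⟩
    have hlt : ∑ x ∈ T, (G'.nbrsIn T x).card < ∑ x ∈ T, (G.nbrsIn T x).card := by
      refine Finset.sum_lt_sum (fun x _ => Finset.card_le_card (hsub x)) ⟨u, hu, ?_⟩
      refine Finset.card_lt_card ⟨hsub u, fun h => ?_⟩
      have := (mem_nbrsIn.1 (h (mem_nbrsIn.2 ⟨hv, huv⟩))).2
      rw [hadj] at this
      simp at this
    obtain ⟨S, hS, hcard⟩ := ih G' hlt hlink
    refine ⟨S, fun x hx => (hS x hx).imp_right fun ⟨y, hy, hyx⟩ => ⟨y, hy, (hadj.1 hyx).1⟩, ?_⟩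
    refine hcard.trans (Nat.add_le_add_right (Finset.sum_le_sum fun x hx => ?_) 2)
    have huv' := huv.ne
    by_cases hxu : x = u
    · subst hxu
      have := card_nbrsIn_le_add_card (G := G) (T := T) (G' := G') (T' := T) (u := x) {v}
        (by intro y hy; rw [hadj]; grind)
      rw [Finset.card_singleton] at this
      unfold weight
      omega
    by_cases hxv : x = v
    · subst hxv
      have := card_nbrsIn_le_add_card (G := G) (T := T) (G' := G') (T' := T) (u := x) {u}
        (by intro y hy; rw [hadj]; grind)
      rw [Finset.card_singleton] at this
      unfold weight
      omega
    · refine weight_le_weight (Finset.card_le_card fun y hy => ?_)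
      rw [mem_nbrsIn, hadj]
      rw [mem_nbrsIn] at hy
      grind
  · right
    unfold Linked at hlink
    push Not at hlink
    obtain ⟨Q, hQT, hQ, hQ', hno⟩ := hlink
    obtain ⟨x, hx, y, hy, hxy⟩ := hT Q hQT hQ hQ'
    have hcross : ∀ x ∈ Q, ∀ y ∈ T \ Q, G.Adj x y → (x = u ∧ y = v) ∨ (x = v ∧ y = u) := by
      intro x hx y hy hxy
      have := hno x hx y hy
      rw [hadj] at this
      tauto
    rcases hcross x hx y hy hxy with ⟨rfl, rfl⟩ | ⟨rfl, rfl⟩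
    · have hcut : G.IsBridgeCut T Q y x :=
        ⟨hQT, hy, hx, hv3, hu3, huv.symm, fun p hp q hq hpq => by
          have := hcross p hp q hq hpq
          grind⟩
      exact ⟨_, hcut.swap⟩
    · exact ⟨Q, hQT, hy, hx, hu3, hv3, huv, fun p hp q hq hpq => by
        have := hcross p hp q hq hpq
        grind⟩

lemma sum_card_nbrsIn_comm (A B : Finset V) :
    ∑ x ∈ A, (G.nbrsIn B x).card = ∑ y ∈ B, (G.nbrsIn A y).card := by
  have := Finset.sum_card_bipartiteAbove_eq_sum_card_bipartiteBelow (s := A) (t := B) G.Adj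
  simpa [Finset.bipartiteAbove, Finset.bipartiteBelow, nbrsIn, G.adj_comm] using this

/-- A bridge cut whose inner side has no edge between vertices of degree at least three. -/
lemma Linked.weightBound_of_isBridgeCut (hT : G.Linked T)
    (ih : ∀ T' : Finset V, T'.card < T.card → G.Linked T' → G.WeightBound T')
    (hlarge : ∀ b ∈ T, (G.nbrsIn T b).card ≤ 2 →
      ∃ w ∈ T, G.Adj b w ∧ 3 ≤ (G.nbrsIn T w).card)
    {u v : V} (hP : G.IsBridgeCut T P u v)
    (hno : ∀ x ∈ P, ∀ y ∈ P, G.Adj x y → 3 ≤ (G.nbrsIn T x).card →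
      (G.nbrsIn T y).card ≤ 2) : G.WeightBound T := by
  obtain ⟨hPT, huT, hvP, hu3, hv3, huv, hcross⟩ := hP
  set L := P.filter fun x => 3 ≤ (G.nbrsIn T x).card with hL
  set A := P \ L with hA
  have hmemL : ∀ x, x ∈ L ↔ x ∈ P ∧ 3 ≤ (G.nbrsIn T x).card := by simp [hL]
  have hLP : L ⊆ P := Finset.filter_subset _ _
  have hvL : v ∈ L := (hmemL v).2 ⟨hvP, hv3⟩
  have hdeg : ∀ x ∈ L, x ≠ v → 3 ≤ (G.nbrsIn A x).card := by
    intro x hx hxv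
    refine ((hmemL x).1 hx).2.trans (Finset.card_le_card fun y hy => ?_)
    rw [mem_nbrsIn] at hy ⊢
    have h1 := hcross x (hLP hx) y
    have h2 := hno x (hLP hx) y
    have h3 := hmemL y
    grind
  have hdegv : 2 ≤ (G.nbrsIn A v).card := by
    have := card_nbrsIn_le_add_card (G := G) (T := T) (G' := G) (T' := A) (u := v) {u}
      (by
        intro y hy hvy
        have h1 := hcross v hvP y
        have h2 := hno v hvP y
        have h3 := hmemL y
        grind)
    rw [Finset.card_singleton] at this
    omega
  have hsumL : 3 * L.card ≤ ∑ x ∈ L, (G.nbrsIn A x).card + 1 := by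
    have := sum_le_sum_add_of_forall_ne (T := L) (f := fun _ => 3)
      (g := fun x => (G.nbrsIn A x).card) v 1 hdeg (fun _ => by omega)
    simpa [mul_comm] using this
  rw [sum_card_nbrsIn_comm] at hsumL
  have hA2 : ∀ a ∈ A, (G.nbrsIn L a).card ≤ 2 := by
    intro a ha
    have h1 : (G.nbrsIn L a).card ≤ (G.nbrsIn T a).card :=
      Finset.card_le_card (Finset.filter_subset_filter _ (hLP.trans hPT))
    have := hmemL a
    grind
  have hAL : A.card + L.card = P.card := Finset.card_sdiff_add_card_eq_card hLP
  have hdomA : ∀ a ∈ A, ∃ w ∈ L, G.Adj a w := by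
    intro a ha
    have h1 := hmemL a
    obtain ⟨w, hw, haw, hw3⟩ := hlarge a (by grind) (by grind)
    have h2 := hcross a (by grind) w
    have h3 := hmemL w
    exact ⟨w, by grind, haw⟩
  by_cases hone : ∃ a ∈ A, (G.nbrsIn L a).card ≤ 1
  · obtain ⟨a, ha, ha1⟩ := hone
    have hlt : ∑ y ∈ A, (G.nbrsIn L y).card < ∑ y ∈ A, 2 :=
      Finset.sum_lt_sum hA2 ⟨a, ha, by omega⟩
    rw [Finset.sum_const, smul_eq_mul] at hlt
    refine hT.weightBound_of_sdiff ih hPT ⟨v, hvP⟩ (D := L) u 0 ?_ ?_ ?_ ?_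
    · intro x hx r hr hxr
      exact (hcross r hr x hx hxr.symm).2
    · intro _
      have := card_nbrsIn_le_add_card (G := G) (T := T) (G' := G) (T' := T \ P) (u := u) {v}
        (by
          intro y hy huy
          have := hcross y
          have := huy.symm
          grind)
      rw [Finset.card_singleton] at this
      unfold weight
      omega
    · intro x hx
      by_cases hxL : x ∈ L
      · exact Or.inl hxL
      · obtain ⟨w, hw, hxw⟩ := hdomA x (by grind)
        exact Or.inr ⟨w, hw, hxw.symm⟩
    · have := two_mul_card_le_sum_weight (G := G) (T := T) P
      omega
  · push Not at hone
    have hle : ∑ y ∈ A, (G.nbrsIn L y).card ≤ ∑ y ∈ A, 2 := Finset.sum_le_sum hA2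
    rw [Finset.sum_const, smul_eq_mul] at hle
    have hPv : (P.erase v).card + 1 = P.card := Finset.card_erase_add_one hvP
    have hLv : (L.erase v).card + 1 = L.card := Finset.card_erase_add_one hvL
    have hApos : 0 < A.card :=
      (show 0 < (G.nbrsIn A v).card by omega).trans_le
        (Finset.card_le_card (Finset.filter_subset _ _))
    have hLpos : 0 < L.card := Finset.card_pos.2 ⟨v, hvL⟩
    refine hT.weightBound_of_sdiff ih (R := P.erase v) ((Finset.erase_subset _ _).trans hPT)
      (Finset.card_pos.1 (by omega)) (D := L.erase v) v 1 ?_ ?_ ?_ ?_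
    · intro x hx r hr hxr
      have := hcross r (by grind) x
      have := hxr.symm
      grind
    · intro _
      have : 0 < (G.nbrsIn (T \ P.erase v) v).card :=
        Finset.card_pos.2 ⟨u, mem_nbrsIn.2 ⟨by grind, huv.symm⟩⟩
      unfold weight
      omega
    · intro x hx
      by_cases hxL : x ∈ L
      · exact Or.inl (by grind)
      · obtain ⟨w, hw, hwv⟩ := Finset.exists_mem_ne (hone x (by grind)) v
        rw [mem_nbrsIn] at hw
        exact Or.inr ⟨w, Finset.mem_erase.2 ⟨hwv, hw.1⟩, hw.2.symm⟩
    · have := two_mul_card_le_sum_weight (G := G) (T := T) (P.erase v)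
      omega

lemma weightBound_of_forall_adj_large
    (hlarge : ∀ b ∈ T, (G.nbrsIn T b).card ≤ 2 →
      ∃ w ∈ T, G.Adj b w ∧ 3 ≤ (G.nbrsIn T w).card)
    (hno : ∀ x ∈ T, ∀ y ∈ T, G.Adj x y → 3 ≤ (G.nbrsIn T x).card →
      (G.nbrsIn T y).card ≤ 2) : G.WeightBound T := by
  set L := T.filter fun x => 3 ≤ (G.nbrsIn T x).card with hL
  set A := T \ L with hA
  have hmemL : ∀ x, x ∈ L ↔ x ∈ T ∧ 3 ≤ (G.nbrsIn T x).card := by simp [hL]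
  have hLT : L ⊆ T := Finset.filter_subset _ _
  have hsumL : L.card * 3 ≤ ∑ x ∈ L, (G.nbrsIn A x).card := by
    refine Finset.card_nsmul_le_sum L _ 3 fun x hx => ?_
    refine ((hmemL x).1 hx).2.trans (Finset.card_le_card fun y hy => ?_)
    rw [mem_nbrsIn] at hy ⊢
    have h2 := hno x (hLT hx) y
    have h3 := hmemL y
    grind
  rw [sum_card_nbrsIn_comm] at hsumL
  have hsumA : ∑ a ∈ A, (G.nbrsIn L a).card ≤ A.card * 2 := by
    refine Finset.sum_le_card_nsmul A _ 2 fun a ha => ?_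
    have h1 : (G.nbrsIn L a).card ≤ (G.nbrsIn T a).card :=
      Finset.card_le_card (Finset.filter_subset_filter _ hLT)
    have := hmemL a
    grind
  have hAL : A.card + L.card = T.card := Finset.card_sdiff_add_card_eq_card hLT
  refine ⟨L, fun x hx => ?_, ?_⟩
  · have h1 := hmemL x
    by_cases hxL : x ∈ L
    · exact Or.inl hxL
    · obtain ⟨w, hw, hxw, hw3⟩ := hlarge x hx (by grind)
      exact Or.inr ⟨w, (hmemL w).2 ⟨hw, hw3⟩, hxw.symm⟩
  · have := two_mul_card_le_sum_weight (G := G) (T := T) T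
    omega

lemma Linked.weightBound_of_forall_smaller (hT : G.Linked T)
    (ih : ∀ (G' : SimpleGraph V) (T' : Finset V), T'.card < T.card → G'.Linked T' →
      G'.WeightBound T')
    (ih' : ∀ G' : SimpleGraph V, ∑ x ∈ T, (G'.nbrsIn T x).card < ∑ x ∈ T, (G.nbrsIn T x).card →
      G'.Linked T → G'.WeightBound T) : G.WeightBound T := by
  rcases hT.weightBound_or_exists_large ih with h | hlarge
  · exact h
  by_contra hnot
  have hbridge : ∀ u ∈ T, ∀ v ∈ T, G.Adj u v → 3 ≤ (G.nbrsIn T u).card →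
      3 ≤ (G.nbrsIn T v).card → ∃ P, G.IsBridgeCut T P u v := fun u hu v hv huv hu3 hv3 =>
    (hT.weightBound_or_exists_isBridgeCut ih' hu hv huv hu3 hv3).resolve_left hnot
  by_cases hcut : ∃ n P u v, G.IsBridgeCut T P u v ∧ P.card = n
  · obtain ⟨P, u, v, hP, hcard⟩ := Nat.find_spec hcut
    refine hnot (hT.weightBound_of_isBridgeCut (ih G) hlarge hP fun x hx y hy hxy hx3 => ?_)
    by_contra! hy3
    -- a bridge cut along an edge inside `P` that leaves `u` outside meets `P` in a smaller one
    have smaller : ∀ Q x' y', x' ∈ P → y' ∈ P → G.IsBridgeCut T Q x' y' → u ∉ Q → False := by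
      intro Q x' y' hx' hy' hQ huQ
      have hvQ : v ∉ Q := by
        intro hvQ
        have := hQ.eq_of_adj v hvQ u (by have := hP.mem_outer; grind) hP.adj.symm
        have := hP.mem_outer
        grind
      have hx'Q := (Finset.mem_sdiff.1 hQ.mem_outer).2
      have hnew : G.IsBridgeCut T (P ∩ Q) x' y' := by
        refine ⟨Finset.inter_subset_left.trans hP.subset, ?_, ?_, hQ.three_le_outer,
          hQ.three_le_inner, hQ.adj, ?_⟩
        · have := hQ.mem_outer
          grind
        · have := hQ.mem_inner
          grind
        · intro p hp q hq hpq
          have h1 := hP.eq_of_adj p (by grind) q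
          have h2 := hQ.eq_of_adj p (by grind) q
          grind
      refine Nat.find_min hcut (m := (P ∩ Q).card) ?_ ⟨_, _, _, hnew, rfl⟩
      rw [← hcard]
      refine Finset.card_lt_card ⟨Finset.inter_subset_left, fun h => ?_⟩
      exact hx'Q (Finset.mem_inter.1 (h hx')).2
    obtain ⟨Q, hQ⟩ := hbridge x (hP.subset hx) y (hP.subset hy) hxy hx3 hy3
    by_cases huQ : u ∈ Q
    · exact smaller _ y x hy hx hQ.swap (by simp [huQ])
    · exact smaller _ x y hx hy hQ huQ
  · refine hnot (weightBound_of_forall_adj_large hlarge fun x hx y hy hxy hx3 => ?_)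
    by_contra! hy3
    obtain ⟨P, hP⟩ := hbridge x hx y hy hxy hx3 hy3
    exact hcut ⟨_, P, x, y, hP, rfl⟩

theorem Linked.weightBound (hT : G.Linked T) : G.WeightBound T := by
  induction hn : T.card using Nat.strong_induction_on generalizing G T with
  | _ n ih =>
    induction hm : ∑ x ∈ T, (G.nbrsIn T x).card using Nat.strong_induction_on generalizing G with
    | _ m ih' =>
      exact hT.weightBound_of_forall_smaller
        (fun G' T' hlt hT' => ih _ (hn ▸ hlt) hT' rfl)
        (fun G' hlt hG' => ih' _ (hm ▸ hlt) hG' rfl)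

lemma Connected.linked_univ [Fintype V] (h : G.Connected) : G.Linked Finset.univ := by
  rintro P - ⟨x, hx⟩ ⟨y, hy⟩
  obtain ⟨w⟩ := h.preconnected x y
  obtain ⟨d, -, hd1, hd2⟩ := w.exists_boundary_dart (P : Set V) hx (by simpa using hy)
  exact ⟨d.fst, hd1, d.snd, by simpa using hd2, d.adj⟩

end RelativeDomination

end SimpleGraph

theorem domination_number_le {V : Type*} [Fintype V] (G : SimpleGraph V)
    [DecidableRel G.Adj] (hconn : G.Connected) (hδ : 2 ≤ G.minDegree) :
    5 * G.dominationNumber ≤ 2 * Fintype.card V + 2 := by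
  classical
  obtain ⟨S, hS, hcard⟩ := hconn.linked_univ.weightBound
  have hw : ∀ v ∈ Finset.univ, G.weight Finset.univ v = 2 := by
    intro v _
    have h1 := hδ.trans (G.minDegree_le_degree v)
    have h2 : G.nbrsIn Finset.univ v = G.neighborFinset v := by
      ext w
      simp [SimpleGraph.mem_nbrsIn]
    rw [SimpleGraph.weight, h2, SimpleGraph.card_neighborFinset_eq_degree]
    omega
  rw [Finset.sum_congr rfl hw, Finset.sum_const, Finset.card_univ, smul_eq_mul] at hcard
  have hle : G.dominationNumber ≤ S.card :=
    Nat.sInf_le ⟨S, fun v hv => (hS v (Finset.mem_univ v)).resolve_left hv, rfl⟩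
  omega
end
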